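/- arXiv:2409.06200 — 2 statements merged into one kernel-verified Lean document; each statement's English description precedes it below -/
import Mathlib

section
/- Let 𝒞 be an extension-closed pseudo-variety of finite groups. (1) If A and B are residually-𝒞 groups such that A is abelian and B is infinite, B satisfies the 𝒞-centralizer condition, and every cyclic subgroup of B is 𝒞-separable in B, then A ≀ B satisfies the 𝒞-centralizer condition. (2) Moreover, if A and B are groups with A nontrivial and B infinite, then A ≀ B is 𝒞-hereditarily conjugacy separable if and only if both of the following hold: (i) A is an abelian residually-𝒞 group; (ii) B is 𝒞-hereditarily conjugacy separable and every cyclic subgroup of B is 𝒞-separable in B. -/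
open Pointwise

universe u

structure ECPseudoVariety : Type (u + 1) where
  mem : ∀ (G : Type u) [Group G], Prop
  finite : ∀ (G : Type u) [Group G], mem G → Finite G
  iso_closed : ∀ (G H : Type u) [Group G] [Group H], G ≃* H → mem G → mem H
  subgroup_closed : ∀ (G : Type u) [Group G] (H : Subgroup G), mem G → mem ↥H
  quotient_closed : ∀ (G : Type u) [Group G] (N : Subgroup G) [N.Normal],
    mem G → mem (G ⧸ N)
  prod_closed : ∀ (G H : Type u) [Group G] [Group H], mem G → mem H → mem (G × H)
  extension_closed : ∀ (G : Type u) [Group G] (N : Subgroup G) [N.Normal],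
    mem ↥N → mem (G ⧸ N) → mem G

namespace ECPseudoVariety

variable (V : ECPseudoVariety.{u})

def coC (G : Type u) [Group G] : Set (Subgroup G) :=
  {N | ∃ hN : N.Normal, haveI := hN; V.mem (G ⧸ N)}

def CSeparable {G : Type u} [Group G] (X : Set G) : Prop :=
  ∀ g : G, g ∉ X → ∃ N ∈ V.coC G, (QuotientGroup.mk g : G ⧸ N) ∉ QuotientGroup.mk '' X

def Residually (G : Type u) [Group G] : Prop :=
  ∀ g : G, g ≠ 1 → ∃ N ∈ V.coC G, g ∉ N

def ConjSep (G : Type u) [Group G] : Prop :=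
  ∀ g : G, V.CSeparable {x : G | IsConj g x}

def COpen {G : Type u} [Group G] (H : Subgroup G) : Prop :=
  ∃ N ∈ V.coC G, N ≤ H

def HCS (G : Type u) [Group G] : Prop :=
  V.ConjSep G ∧ ∀ H : Subgroup G, V.COpen H → V.ConjSep ↥H

def CyclicSep (G : Type u) [Group G] : Prop :=
  ∀ g : G, V.CSeparable ((Subgroup.zpowers g : Subgroup G) : Set G)

end ECPseudoVariety

def CCWitness {G : Type u} [Group G] (g : G) (K L : Subgroup G) [L.Normal] : Prop :=
  (Subgroup.centralizer {(QuotientGroup.mk g : G ⧸ L)} : Set (G ⧸ L)) ⊆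
    QuotientGroup.mk '' ((Subgroup.centralizer {g} : Set G) * (K : Set G))

namespace ECPseudoVariety

variable (V : ECPseudoVariety.{u})

def SatisfiesCCAt {G : Type u} [Group G] (g : G) : Prop :=
  ∀ K ∈ V.coC G, ∃ L ∈ V.coC G, L ≤ K ∧ ∃ hL : L.Normal, haveI := hL; CCWitness g K L

def SatisfiesCC (G : Type u) [Group G] : Prop :=
  ∀ g : G, V.SatisfiesCCAt g

end ECPseudoVariety

/-- `G` is conjugacy separable. -/
def IsConjSeparable (G : Type u) [Group G] : Prop :=
  ∀ x y : G, ¬ IsConj x y → ∃ N : Subgroup G, ∃ hN : N.Normal, N.FiniteIndex ∧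
    (haveI := hN; ¬ IsConj (QuotientGroup.mk x : G ⧸ N) (QuotientGroup.mk y))

/-- `G` is hereditarily conjugacy separable: every finite-index subgroup is
conjugacy separable. -/
def IsHereditarilyConjSeparable (G : Type u) [Group G] : Prop :=
  ∀ H : Subgroup G, H.FiniteIndex → IsConjSeparable H

/-- `G` is residually finite. -/
def IsResiduallyFinite (G : Type u) [Group G] : Prop :=
  ∀ g : G, g ≠ 1 → ∃ N : Subgroup G, N.Normal ∧ N.FiniteIndex ∧ g ∉ N

/-- Normal subgroups with finite `p`-group quotient. -/
def pCoC (p : ℕ) (G : Type u) [Group G] : Set (Subgroup G) :=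
  {N | ∃ hN : N.Normal, Finite (G ⧸ N) ∧ (haveI := hN; IsPGroup p (G ⧸ N))}

/-- `G` is `p`-conjugacy separable. -/
def pConjSep (p : ℕ) (G : Type u) [Group G] : Prop :=
  ∀ x y : G, ¬ IsConj x y → ∃ N ∈ pCoC p G, ∃ hN : N.Normal,
    haveI := hN; ¬ IsConj (QuotientGroup.mk x : G ⧸ N) (QuotientGroup.mk y)

/-- A subgroup is `p`-open if it contains a normal subgroup with finite
`p`-group quotient. -/
def pOpen (p : ℕ) {G : Type u} [Group G] (H : Subgroup G) : Prop :=
  ∃ N ∈ pCoC p G, N ≤ H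

/-- `G` is `p`-hereditarily conjugacy separable. -/
def pHCS (p : ℕ) (G : Type u) [Group G] : Prop :=
  pConjSep p G ∧ ∀ H : Subgroup G, pOpen p H → pConjSep p H

/-- The base group of the restricted wreath product: finitely supported functions `B → A`. -/
def WreathBase (A B : Type u) [Group A] : Subgroup (B → A) where
  carrier := {f | (Function.mulSupport f).Finite}
  one_mem' := by simp
  mul_mem' := fun hf hg =>
    Set.Finite.subset (Set.Finite.union hf hg) (Function.mulSupport_mul _ _)
  inv_mem' := fun hf => Set.Finite.subset hf fun x hx => by
    simp only [Function.mem_mulSupport] at hx ⊢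
    simpa using hx

/-- Shift automorphism of the base group: `(c • f) x = f (c⁻¹ * x)`. -/
def wreathShift (A B : Type u) [Group A] [Group B] (c : B) :
    WreathBase A B ≃* WreathBase A B where
  toFun f := ⟨fun x => (f : B → A) (c⁻¹ * x), by
    have hsub : (Function.mulSupport fun x => (f : B → A) (c⁻¹ * x)) ⊆
        (fun x : B => c * x) '' Function.mulSupport (f : B → A) := by
      intro x hx
      exact ⟨c⁻¹ * x, hx, by simp⟩
    exact (f.2.image _).subset hsub⟩
  invFun f := ⟨fun x => (f : B → A) (c * x), by
    have hsub : (Function.mulSupport fun x => (f : B → A) (c * x)) ⊆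
        (fun x : B => c⁻¹ * x) '' Function.mulSupport (f : B → A) := by
      intro x hx
      exact ⟨c * x, hx, by simp⟩
    exact (f.2.image _).subset hsub⟩
  left_inv f := Subtype.ext (funext fun x => by simp)
  right_inv f := Subtype.ext (funext fun x => by simp)
  map_mul' f g := rfl

/-- The action of `B` on the base group of the wreath product. -/
def wreathAction (A B : Type u) [Group A] [Group B] : B →* MulAut (WreathBase A B) where
  toFun := wreathShift A B
  map_one' := by
    apply MulEquiv.ext
    intro f
    apply Subtype.ext
    funext x
    show (f : B → A) ((1 : B)⁻¹ * x) = (f : B → A) x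
    simp
  map_mul' c d := by
    apply MulEquiv.ext
    intro f
    apply Subtype.ext
    funext x
    show (f : B → A) ((c * d)⁻¹ * x) = (f : B → A) (d⁻¹ * (c⁻¹ * x))
    rw [mul_inv_rev, mul_assoc]

/-- The restricted wreath product `A ≀ B`. -/
abbrev RWreath (A B : Type u) [Group A] [Group B] : Type u :=
  SemidirectProduct (WreathBase A B) B (wreathAction A B)
def rcoset {B : Type u} [Group B] (b x : B) : Set B :=
  {y : B | y * x⁻¹ ∈ Subgroup.zpowers b}

lemma rcoset_mul_left {B : Type u} [Group B] {b c : B}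
    (hc : c ∈ Subgroup.centralizer {b}) (y : B) :
    rcoset b (c * y) = (c * ·) '' rcoset b y := by
  have hcomm : b * c = c * b := Subgroup.mem_centralizer_iff.mp hc b rfl
  have hC : Commute b c := hcomm
  ext z
  simp only [rcoset, Set.mem_setOf_eq, Set.mem_image]
  constructor
  · intro hz
    refine ⟨c⁻¹ * z, ?_, by group⟩
    obtain ⟨k, hk⟩ := Subgroup.mem_zpowers_iff.mp hz
    refine Subgroup.mem_zpowers_iff.mpr ⟨k, ?_⟩
    have hcc : b ^ k * c = c * b ^ k := (hC.zpow_left k).eq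
    have hk' : z * y⁻¹ = b ^ k * c := by
      rw [hk]; group
    calc b ^ k = c⁻¹ * (c * b ^ k) := by group
      _ = c⁻¹ * (b ^ k * c) := by rw [hcc]
      _ = c⁻¹ * (z * y⁻¹) := by rw [hk']
      _ = c⁻¹ * z * y⁻¹ := by group
  · rintro ⟨w, hw, rfl⟩
    obtain ⟨k, hk⟩ := Subgroup.mem_zpowers_iff.mp hw
    refine Subgroup.mem_zpowers_iff.mpr ⟨k, ?_⟩
    have hcc : b ^ k * c = c * b ^ k := (hC.zpow_left k).eq
    calc b ^ k = c * b ^ k * c⁻¹ := by rw [← hcc]; group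
      _ = c * (w * y⁻¹) * c⁻¹ := by rw [hk]
      _ = c * w * (c * y)⁻¹ := by group

/-- An element `fb` of `A ≀ B` is reduced if distinct elements of `supp f` lie in
distinct right cosets of `⟨b⟩`. -/
def IsReducedPair {A B : Type u} [Group A] [Group B] (f : WreathBase A B) (b : B) : Prop :=
  ∀ s ∈ Function.mulSupport (f : B → A), ∀ t ∈ Function.mulSupport (f : B → A),
    t * s⁻¹ ∈ Subgroup.zpowers b → s = t

/-- The set `C_B(f,b) = C⁺_B(f,b) ∩ C_B(b)`. -/
def CBset {A B : Type u} [Group A] [Group B] (f : WreathBase A B) (b : B) : Set B :=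
  {c | c ∈ Subgroup.centralizer {b} ∧
    ∀ a : A, a ≠ 1 → a ∈ Set.range (f : B → A) →
      (fun s : B => rcoset b (c * s)) '' ((f : B → A) ⁻¹' {a}) =
        rcoset b '' ((f : B → A) ⁻¹' {a})}

/-- `C_B(f,b)` as a subgroup of `B`. -/
def CBsubgroup {A B : Type u} [Group A] [Group B] (f : WreathBase A B) (b : B) :
    Subgroup B where
  carrier := CBset f b
  one_mem' := by
    refine ⟨Subgroup.one_mem _, ?_⟩
    intro a _ _
    simp
  mul_mem' := by
    rintro c c' ⟨hc1, hc2⟩ ⟨hc'1, hc'2⟩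
    refine ⟨Subgroup.mul_mem _ hc1 hc'1, ?_⟩
    intro a ha har
    calc (fun s : B => rcoset b (c * c' * s)) '' ((f : B → A) ⁻¹' {a})
        = (fun s : B => (c * ·) '' rcoset b (c' * s)) '' ((f : B → A) ⁻¹' {a}) := by
          have he : (fun s : B => rcoset b (c * c' * s)) =
              fun s : B => (c * ·) '' rcoset b (c' * s) := by
            funext s; rw [mul_assoc, rcoset_mul_left hc1]
          rw [he]
      _ = (fun X : Set B => (c * ·) '' X) ''
            ((fun s : B => rcoset b (c' * s)) '' ((f : B → A) ⁻¹' {a})) := by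
          rw [Set.image_image]
      _ = (fun X : Set B => (c * ·) '' X) '' (rcoset b '' ((f : B → A) ⁻¹' {a})) := by
          rw [hc'2 a ha har]
      _ = (fun s : B => (c * ·) '' rcoset b s) '' ((f : B → A) ⁻¹' {a}) := by
          rw [Set.image_image]
      _ = (fun s : B => rcoset b (c * s)) '' ((f : B → A) ⁻¹' {a}) := by
          have he : (fun s : B => (c * ·) '' rcoset b s) =
              fun s : B => rcoset b (c * s) := by
            funext s; rw [rcoset_mul_left hc1]
          rw [he]
      _ = rcoset b '' ((f : B → A) ⁻¹' {a}) := hc2 a ha har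
  inv_mem' := by
    rintro c ⟨hc1, hc2⟩
    have hinv : c⁻¹ ∈ Subgroup.centralizer {b} := Subgroup.inv_mem _ hc1
    refine ⟨hinv, ?_⟩
    intro a ha har
    calc (fun s : B => rcoset b (c⁻¹ * s)) '' ((f : B → A) ⁻¹' {a})
        = (fun s : B => (c⁻¹ * ·) '' rcoset b s) '' ((f : B → A) ⁻¹' {a}) := by
          have he : (fun s : B => rcoset b (c⁻¹ * s)) =
              fun s : B => (c⁻¹ * ·) '' rcoset b s := by
            funext s; rw [rcoset_mul_left hinv]
          rw [he]
      _ = (fun X : Set B => (c⁻¹ * ·) '' X) '' (rcoset b '' ((f : B → A) ⁻¹' {a})) := by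
          rw [Set.image_image]
      _ = (fun X : Set B => (c⁻¹ * ·) '' X) ''
            ((fun s : B => rcoset b (c * s)) '' ((f : B → A) ⁻¹' {a})) := by
          rw [hc2 a ha har]
      _ = (fun s : B => (c⁻¹ * ·) '' rcoset b (c * s)) '' ((f : B → A) ⁻¹' {a}) := by
          rw [Set.image_image]
      _ = rcoset b '' ((f : B → A) ⁻¹' {a}) := by
          have he : (fun s : B => (c⁻¹ * ·) '' rcoset b (c * s)) =
              fun s : B => rcoset b s := by
            funext s; rw [← rcoset_mul_left hinv, inv_mul_cancel_left]
          rw [he]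

/-- The permutation group condition set `Σ(f,b)`. -/
def SigmaSet {A B : Type u} [Group A] [Group B] (f : WreathBase A B) (b : B) :
    Set (Equiv.Perm ↥(Function.mulSupport (f : B → A))) :=
  {σ | ∀ a : A, a ≠ 1 →
    (fun s : ↥(Function.mulSupport (f : B → A)) => rcoset b ↑(σ s)) ''
        {s : ↥(Function.mulSupport (f : B → A)) | (f : B → A) ↑s = a} =
      (fun s : ↥(Function.mulSupport (f : B → A)) => rcoset b ↑s) ''
        {s : ↥(Function.mulSupport (f : B → A)) | (f : B → A) ↑s = a}}

namespace WI
variable {V : ECPseudoVariety.{u}}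

section gen
variable {G H : Type u} [Group G] [Group H]

lemma mem_of_inj (f : G →* H) (hf : Function.Injective f) (h : V.mem H) : V.mem G :=
  V.iso_closed _ _ (MonoidHom.ofInjective hf).symm (V.subgroup_closed _ f.range h)

lemma mem_of_surj (f : G →* H) (hf : Function.Surjective f) (h : V.mem G) : V.mem H :=
  V.iso_closed _ _ (QuotientGroup.quotientKerEquivOfSurjective f hf) (V.quotient_closed _ f.ker h)

lemma coC_of_ker_le (f : G →* H) (h : V.mem H) (N : Subgroup G) (hn : N.Normal)
    (hN : f.ker ≤ N) : N ∈ V.coC G := by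
  refine ⟨hn, ?_⟩
  have h1 : V.mem (G ⧸ f.ker) :=
    mem_of_inj (QuotientGroup.kerLift f) (QuotientGroup.kerLift_injective f) h
  refine mem_of_surj (QuotientGroup.map f.ker N (MonoidHom.id G) hN) ?_ h1
  intro x
  obtain ⟨y, rfl⟩ := QuotientGroup.mk_surjective x
  exact ⟨QuotientGroup.mk y, rfl⟩

lemma coC_normal {N : Subgroup G} (h : N ∈ V.coC G) : N.Normal := h.1

lemma coC_finite {N : Subgroup G} (h : N ∈ V.coC G) : Finite (G ⧸ N) := by
  obtain ⟨h1, h2⟩ := h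
  exact V.finite _ h2

lemma coC_comap (f : G →* H) {N : Subgroup H} (h : N ∈ V.coC H) : N.comap f ∈ V.coC G := by
  obtain ⟨h1, h2⟩ := h
  refine coC_of_ker_le ((QuotientGroup.mk' N).comp f) h2 _ inferInstance ?_
  intro x hx
  simpa [MonoidHom.mem_ker] using hx

lemma coC_inf {N M : Subgroup G} (hN : N ∈ V.coC G) (hM : M ∈ V.coC G) : N ⊓ M ∈ V.coC G := by
  obtain ⟨h1, h2⟩ := hN
  obtain ⟨h3, h4⟩ := hM
  refine coC_of_ker_le ((QuotientGroup.mk' N).prod (QuotientGroup.mk' M))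
    (V.prod_closed _ _ h2 h4) _ inferInstance ?_
  intro x hx
  simpa [MonoidHom.mem_ker, Prod.ext_iff] using hx

lemma coC_mono {N M : Subgroup G} (hN : N ∈ V.coC G) (hM : M.Normal) (h : N ≤ M) :
    M ∈ V.coC G := by
  obtain ⟨h1, h2⟩ := hN
  exact coC_of_ker_le (QuotientGroup.mk' N) h2 _ hM (by simpa using h)

lemma coC_top_of {N : Subgroup H} (hN : N ∈ V.coC H) : (⊤ : Subgroup G) ∈ V.coC G := by
  obtain ⟨h1, h2⟩ := hN
  exact coC_of_ker_le (1 : G →* H ⧸ N) h2 _ inferInstance le_top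

/-- finite simultaneous choice -/
lemma coC_fin {ι : Type*} (S : Set ι) (hS : S.Finite) (P : ι → Subgroup G → Prop)
    (hne : ∃ N, N ∈ V.coC G)
    (hm : ∀ i N M, N ≤ M → P i M → P i N)
    (h : ∀ i ∈ S, ∃ N ∈ V.coC G, P i N) : ∃ N ∈ V.coC G, ∀ i ∈ S, P i N := by
  induction S, hS using Set.Finite.induction_on with
  | empty => obtain ⟨N, hN⟩ := hne; exact ⟨N, hN, by simp⟩
  | @insert a s _ _ ih =>
    obtain ⟨N, hN, h1⟩ := ih (fun i hi => h i (Set.mem_insert_of_mem _ hi))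
    obtain ⟨M, hM, h2⟩ := h a (Set.mem_insert _ _)
    refine ⟨N ⊓ M, coC_inf hN hM, ?_⟩
    rintro i (rfl | hi)
    · exact hm _ _ _ inf_le_right h2
    · exact hm _ _ _ inf_le_left (h1 i hi)

lemma mem_pi_fin (hG : V.mem G) (n : ℕ) : V.mem (Fin n → G) := by
  induction n with
  | zero => exact mem_of_surj (1 : G →* (Fin 0 → G)) (fun x => ⟨1, Subsingleton.elim _ _⟩) hG
  | succ n ih =>
    refine mem_of_inj (H := G × (Fin n → G))
      ⟨⟨fun x => (x 0, fun i => x i.succ), rfl⟩, fun _ _ => rfl⟩ ?_ (V.prod_closed _ _ hG ih)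
    intro x y hxy
    simp only [MonoidHom.coe_mk, OneHom.coe_mk, Prod.mk.injEq] at hxy
    funext i
    refine Fin.cases hxy.1 (fun j => congrFun hxy.2 j) i

lemma mem_pi (ι : Type u) [Finite ι] (hG : V.mem G) : V.mem (ι → G) := by
  obtain ⟨n, ⟨e⟩⟩ := Finite.exists_equiv_fin ι
  refine mem_of_inj (H := Fin n → G)
      ⟨⟨fun x i => x (e.symm i), rfl⟩, fun _ _ => rfl⟩ ?_ (mem_pi_fin hG n)
  intro x y hxy
  funext i
  have := congrFun hxy (e i)
  simpa using this

lemma coC_ext {K L : Subgroup G} (hK : K ∈ V.coC G) (hL : L.Normal) (hLK : L ≤ K)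
    (ψ : K →* H) (hH : V.mem H) (hψ : ∀ k : K, ψ k = 1 → (k : G) ∈ L) : L ∈ V.coC G := by
  obtain ⟨h1, h2⟩ := hK
  refine ⟨hL, ?_⟩
  refine V.extension_closed (G ⧸ L) (K.map (QuotientGroup.mk' L)) ?_ ?_
  · have hh : L.subgroupOf K ∈ V.coC K :=
      coC_of_ker_le ψ hH _ inferInstance (fun k hk => hψ k hk)
    obtain ⟨h3, h4⟩ := hh
    let φ : K →* K.map (QuotientGroup.mk' L) := (QuotientGroup.mk' L).subgroupMap K
    have hφ : L.subgroupOf K ≤ φ.ker := by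
      intro k hk
      rw [MonoidHom.mem_ker]
      apply Subtype.ext
      exact (QuotientGroup.eq_one_iff _).2 hk
    refine mem_of_surj (QuotientGroup.lift (L.subgroupOf K) φ hφ) ?_ h4
    intro x
    obtain ⟨y, hy⟩ := (QuotientGroup.mk' L).subgroupMap_surjective K x
    exact ⟨QuotientGroup.mk y, hy⟩
  · exact V.iso_closed _ _ (QuotientGroup.quotientQuotientEquivQuotient L K hLK).symm h2

/-- cores of open subgroups -/
lemma coC_core {Hs : Subgroup G} (hHs : V.COpen Hs) {N : Subgroup Hs} (hN : N ∈ V.coC Hs) :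
    ∃ L ∈ V.coC G, ∀ l ∈ L, ∃ h : l ∈ Hs, (⟨l, h⟩ : Hs) ∈ N := by
  obtain ⟨K, hK, hKH⟩ := hHs
  have hKf := coC_finite hK
  have hKn := coC_normal hK
  obtain ⟨hNn, hN2⟩ := hN
  have hc : ∀ (x : G) (k : K), x⁻¹ * k * x ∈ Hs := fun x k =>
    hKH (by simpa using hKn.conj_mem k k.2 x⁻¹)
  let ψ : K →* (G ⧸ K → Hs ⧸ N) :=
    { toFun := fun k q => QuotientGroup.mk ⟨q.out⁻¹ * k * q.out, hc _ k⟩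
      map_one' := by
        funext q
        refine (QuotientGroup.eq_one_iff _).2 ?_
        convert N.one_mem
        simp
      map_mul' := by
        intro a b
        funext q
        simp only [Pi.mul_apply, ← QuotientGroup.mk_mul]
        congr 1
        apply Subtype.ext; simp [mul_assoc] }
  have key : ∀ k : K, ψ k = 1 → ∀ x : G, (⟨x⁻¹ * k * x, hc x k⟩ : Hs) ∈ N := by
    intro k hk x
    have h1 := congrFun hk (QuotientGroup.mk x)
    have h2 := (QuotientGroup.eq_one_iff _).1 h1
    obtain ⟨t, ht⟩ := QuotientGroup.mk_out_eq_mul K x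
    have := hNn.conj_mem _ h2 ⟨(t : G), hKH t.2⟩
    convert this using 1
    apply Subtype.ext
    simp [ht]; group
  refine ⟨ψ.ker.map K.subtype, coC_ext hK ?_ ?_ ψ (mem_pi _ hN2) ?_, ?_⟩
  · constructor
    rintro _ ⟨k, hk, rfl⟩ g
    refine ⟨⟨g * k * g⁻¹, hKn.conj_mem _ k.2 g⟩, ?_, rfl⟩
    refine MonoidHom.mem_ker.2 ?_
    funext q
    refine (QuotientGroup.eq_one_iff _).2 ?_
    have := key k hk (g⁻¹ * q.out)
    convert this using 1
    apply Subtype.ext; simp [mul_assoc]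
  · rintro _ ⟨k, hk, rfl⟩
    exact k.2
  · intro k hk
    exact ⟨k, hk, rfl⟩
  · rintro _ ⟨k, hk, rfl⟩
    refine ⟨hKH k.2, ?_⟩
    simpa using key k hk 1

/-- transporter property -/
def P (V : ECPseudoVariety.{u}) {G : Type u} [Group G] (g y : G) : Prop :=
  ∀ K ∈ V.coC G, ∃ L ∈ V.coC G, ∀ z : G, z * g * z⁻¹ * y⁻¹ ∈ L →
    ∃ t : G, t * g * t⁻¹ = y ∧ t⁻¹ * z ∈ K

lemma CC_of_P (g : G) (h : P V g g) : V.SatisfiesCCAt g := by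
  intro K hK
  obtain ⟨L, hL, h⟩ := h K hK
  have hLn := coC_normal hL
  have hKn := coC_normal hK
  refine ⟨L ⊓ K, coC_inf hL hK, inf_le_right, inferInstance, ?_⟩
  intro x hx
  obtain ⟨z, rfl⟩ := QuotientGroup.mk_surjective x
  have h1 := Subgroup.mem_centralizer_iff.1 hx _ rfl
  rw [← QuotientGroup.mk_mul, ← QuotientGroup.mk_mul, QuotientGroup.eq] at h1
  have h2 : z * g * z⁻¹ * g⁻¹ ∈ L := by
    have := hLn.conj_mem _ h1.1 (g * z)
    convert this using 1
    group
  obtain ⟨t, ht, hk⟩ := h z h2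
  refine ⟨z, ?_, rfl⟩
  refine ⟨t, ?_, t⁻¹ * z, hk, by simp⟩
  refine Subgroup.mem_centralizer_iff.2 ?_
  rintro _ rfl
  nth_rewrite 1 [← ht]
  group

lemma P_of_CC (g : G) (h : V.SatisfiesCCAt g) : P V g g := by
  intro K hK
  obtain ⟨L, hL, hLK, hLn, h⟩ := h K hK
  refine ⟨L, hL, ?_⟩
  intro z hz
  have : (QuotientGroup.mk z : G ⧸ L) ∈
      (Subgroup.centralizer {(QuotientGroup.mk g : G ⧸ L)} : Set (G ⧸ L)) := by
    refine Subgroup.mem_centralizer_iff.2 ?_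
    rintro _ rfl
    rw [← QuotientGroup.mk_mul, ← QuotientGroup.mk_mul, QuotientGroup.eq]
    have := hLn.conj_mem _ hz (g * z)⁻¹
    convert this using 1
    group
  obtain ⟨_, ⟨t, ht, k, hk, rfl⟩, h3⟩ := h this
  refine ⟨t, ?_, ?_⟩
  · have := Subgroup.mem_centralizer_iff.1 ht _ rfl
    rw [← this]; group
  · rw [QuotientGroup.eq] at h3
    have := K.mul_mem hk (hLK h3)
    convert this using 1
    simp; group

/-- Separating form of conjugacy separability -/
lemma conjSep_iff (g y : G) (N : Subgroup G) (hN : N.Normal) :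
    (QuotientGroup.mk y : G ⧸ N) ∈ QuotientGroup.mk '' {x : G | IsConj g x} ↔
      ∃ z : G, z * g * z⁻¹ * y⁻¹ ∈ N := by
  constructor
  · rintro ⟨x, hx, h⟩
    obtain ⟨z, rfl⟩ := isConj_iff.1 hx
    refine ⟨z, ?_⟩
    have := hN.mem_comm (QuotientGroup.eq.1 h)
    have := N.inv_mem this
    convert this using 1
    group
  · rintro ⟨z, hz⟩
    refine ⟨z * g * z⁻¹, isConj_iff.2 ⟨z, rfl⟩, ?_⟩
    rw [QuotientGroup.eq]
    have := N.inv_mem (hN.mem_comm hz)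
    convert this using 1
    group

lemma conjSep_of_P (h : ∀ g y : G, P V g y) (hne : ∃ N, N ∈ V.coC G) : V.ConjSep G := by
  obtain ⟨N, hN⟩ := hne
  intro g y hy
  obtain ⟨L, hL, h⟩ := h g y N hN
  refine ⟨L, hL, ?_⟩
  rw [conjSep_iff _ _ _ (coC_normal hL)]
  rintro ⟨z, hz⟩
  obtain ⟨t, ht, _⟩ := h z hz
  exact hy (isConj_iff.2 ⟨t, ht⟩)

lemma HCS_of_P (h : ∀ g y : G, P V g y) (hne : ∃ N, N ∈ V.coC G) : V.HCS G := by
  refine ⟨conjSep_of_P h hne, ?_⟩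
  rintro Hs ⟨K, hK, hKH⟩
  intro g y hy
  obtain ⟨L, hL, h⟩ := h g y K hK
  refine ⟨L.comap Hs.subtype, coC_comap _ hL, ?_⟩
  rw [conjSep_iff _ _ _ ((coC_normal hL).comap _)]
  rintro ⟨z, hz⟩
  obtain ⟨t, ht, hk⟩ := h z hz
  have hk := hKH hk
  have : t ∈ Hs := by
    have := Hs.mul_mem z.2 (Hs.inv_mem hk)
    convert this using 1
    group
  exact hy (isConj_iff.2 ⟨⟨t, this⟩, Subtype.ext ht⟩)

lemma P_of_HCS (h : V.HCS G) (g y : G) : P V g y := by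
  intro K hK
  have hKn := coC_normal hK
  have hKf := coC_finite hK
  have main : ∀ q : G ⧸ K, q ∈ (Set.univ : Set (G ⧸ K)) → ∃ L ∈ V.coC G,
      ∀ z : G, (QuotientGroup.mk z : G ⧸ K) = q → z * g * z⁻¹ * y⁻¹ ∈ L →
      ∃ t : G, t * g * t⁻¹ = y ∧ t⁻¹ * z ∈ K := by
    intro q _
    obtain ⟨x, rfl⟩ := QuotientGroup.mk_surjective q
    by_cases hx : ∃ t : G, t * g * t⁻¹ = y ∧ t⁻¹ * x ∈ K
    · obtain ⟨t, ht, htx⟩ := hx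
      refine ⟨K, hK, fun z hz _ => ⟨t, ht, ?_⟩⟩
      have := K.mul_mem htx (QuotientGroup.eq.1 hz.symm)
      convert this using 1
      group
    · have hx : ∀ k ∈ K, k * g * k⁻¹ ≠ x⁻¹ * y * x := by
        intro k hk he
        refine hx ⟨x * k, ?_, ?_⟩
        · calc x * k * g * (x * k)⁻¹ = x * (k * g * k⁻¹) * x⁻¹ := by group
            _ = y := by rw [he]; group
        · simpa using hk
      have red : ∀ L : Subgroup G, L.Normal → ∀ z : G,
          (QuotientGroup.mk z : G ⧸ K) = QuotientGroup.mk x → z * g * z⁻¹ * y⁻¹ ∈ L →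
          ∃ k ∈ K, k * g * k⁻¹ * (x⁻¹ * y * x)⁻¹ ∈ L := by
        intro L hL z hz hzL
        refine ⟨x⁻¹ * z, QuotientGroup.eq.1 hz.symm, ?_⟩
        have := hL.conj_mem _ hzL x⁻¹
        convert this using 1
        group
      have hgH : g ∈ Subgroup.zpowers g ⊔ K := Subgroup.mem_sup_left (Subgroup.mem_zpowers g)
      by_cases hyH : x⁻¹ * y * x ∈ Subgroup.zpowers g ⊔ K
      · have hop : V.COpen (Subgroup.zpowers g ⊔ K) := ⟨K, hK, le_sup_right⟩
        obtain ⟨N, hN, hsep⟩ := h.2 _ hop ⟨g, hgH⟩ ⟨x⁻¹ * y * x, hyH⟩ (by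
          intro hc
          obtain ⟨⟨c, hc⟩, hc2⟩ := isConj_iff.1 hc
          have hc2 := congrArg Subtype.val hc2
          simp only [Subgroup.coe_mul, Subgroup.coe_inv] at hc2
          rw [sup_comm] at hc
          obtain ⟨k, hk, w, hw, rfl⟩ := Subgroup.mem_sup_of_normal_left.1 hc
          obtain ⟨n, rfl⟩ := Subgroup.mem_zpowers_iff.1 hw
          apply hx k hk
          rw [← hc2]
          have : g ^ n * g * (g ^ n)⁻¹ = g := by
            rw [(Commute.zpow_self g n).eq]; group
          calc k * g * k⁻¹ = k * (g ^ n * g * (g ^ n)⁻¹) * k⁻¹ := by rw [this]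
            _ = _ := by group)
        rw [conjSep_iff _ _ _ (coC_normal hN)] at hsep
        obtain ⟨L, hL, hLN⟩ := coC_core hop hN
        refine ⟨L, hL, fun z hz hzL => ?_⟩
        exfalso
        obtain ⟨k, hk, hkL⟩ := red L (coC_normal hL) z hz hzL
        obtain ⟨h1, h2⟩ := hLN _ hkL
        exact hsep ⟨⟨k, Subgroup.mem_sup_right hk⟩, h2⟩
      · refine ⟨K, hK, fun z hz hzL => ?_⟩
        exfalso
        obtain ⟨k, hk, hkL⟩ := red K hKn z hz hzL
        have h1 := Subgroup.mem_sup_right (S := Subgroup.zpowers g) hk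
        have h2 := Subgroup.mem_sup_right (S := Subgroup.zpowers g) hkL
        apply hyH
        have := mul_mem (inv_mem h2) (mul_mem (mul_mem h1 hgH) (inv_mem h1))
        convert this using 1
        group
  obtain ⟨L, hL, h⟩ := coC_fin (V := V) (G := G) Set.univ Set.finite_univ
    (fun (q : G ⧸ K) L => ∀ z : G, (QuotientGroup.mk z : G ⧸ K) = q → z * g * z⁻¹ * y⁻¹ ∈ L →
      ∃ t : G, t * g * t⁻¹ = y ∧ t⁻¹ * z ∈ K) ⟨K, hK⟩
    (fun i N M hNM hM z hz hzN => hM z hz (hNM hzN)) main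
  exact ⟨L, hL, fun z hz => h _ trivial z rfl hz⟩

lemma res_of_conjSep (h : V.ConjSep G) : V.Residually G := by
  intro g hg
  obtain ⟨N, hN, h⟩ := h 1 g (by simpa using hg)
  refine ⟨N, hN, fun hgN => h ⟨1, by simp, ?_⟩⟩
  have := coC_normal hN
  rw [QuotientGroup.eq]
  simpa using hgN

lemma res_of_inj (f : G →* H) (hf : Function.Injective f) (h : V.Residually H) :
    V.Residually G := by
  intro g hg
  obtain ⟨N, hN, h⟩ := h (f g) (by rwa [Ne, map_eq_one_iff f hf])
  exact ⟨N.comap f, coC_comap f hN, h⟩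

lemma sep_iff (X : Set G) (h : V.CSeparable X) (g : G) (hg : g ∉ X) :
    ∃ N ∈ V.coC G, ∀ x ∈ X, ∀ n ∈ N, g ≠ x * n := by
  obtain ⟨N, hN, h⟩ := h g hg
  refine ⟨N, hN, ?_⟩
  rintro x hx n hn rfl
  refine h ⟨x, hx, ?_⟩
  rw [QuotientGroup.eq]
  simpa using hn

end gen
end WI

namespace WI
set_option linter.unusedSectionVars false
section modl
variable {V : ECPseudoVariety.{u}} {B α : Type u} [Group B] [AddCommGroup α]

/-- push-forward -/
noncomputable def Phi {X β : Type*} [AddCommGroup β] (q : α →+ β) (π : B → X) :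
    (B →₀ α) →+ (X →₀ β) :=
  (Finsupp.mapRange.addMonoidHom q).comp (Finsupp.mapDomain.addMonoidHom π)

lemma Phi_apply {X β : Type*} [AddCommGroup β] (q : α →+ β) (π : B → X) (f : B →₀ α) (x : X) :
    Phi q π f x = q (Finsupp.mapDomain π f x) := rfl

@[simp] lemma Phi_single {X β : Type*} [AddCommGroup β] (q : α →+ β) (π : B → X) (x : B) (a : α) :
    Phi q π (Finsupp.single x a) = Finsupp.single (π x) (q a) := by
  simp [Phi]

/-- translation -/
noncomputable def act (c : B) : (B →₀ α) →+ (B →₀ α) :=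
  Finsupp.mapDomain.addMonoidHom (c * ·)

@[simp] lemma act_single (c x : B) (a : α) :
    act c (Finsupp.single x a) = Finsupp.single (c * x) a := by
  simp [act]

lemma act_act (c d : B) (f : B →₀ α) : act c (act d f) = act (c * d) f := by
  induction f using Finsupp.induction_linear with
  | zero => simp
  | add f g hf hg => simp only [map_add, hf, hg]
  | single x a => simp [mul_assoc]

@[simp] lemma act_one (f : B →₀ α) : act 1 f = f := by
  induction f using Finsupp.induction_linear with
  | zero => simp
  | add f g hf hg => simp only [map_add, hf, hg]
  | single x a => simp

lemma act_apply (c x : B) (f : B →₀ α) : act c f x = f (c⁻¹ * x) := by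
  have := Finsupp.mapDomain_apply (mul_right_injective c) f (c⁻¹ * x)
  simpa [act] using this

lemma ker_le {X β : Type*} [AddCommGroup β] (q : α →+ β) (π : B → X) (D : AddSubgroup (B →₀ α))
    (h1 : ∀ x y a, π x = π y → Finsupp.single x a - Finsupp.single y a ∈ D)
    (h2 : ∀ x a, q a = 0 → Finsupp.single x a ∈ D) (f : B →₀ α) (hf : Phi q π f = 0) : f ∈ D := by
  classical
  let σ : X → B := Function.invFun π
  have hσ : ∀ x, π (σ (π x)) = π x := fun x => Function.invFun_eq ⟨x, rfl⟩
  have e1 : ∀ f : B →₀ α, f - Finsupp.mapDomain σ (Finsupp.mapDomain π f) ∈ D := by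
    intro f
    induction f using Finsupp.induction_linear with
    | zero => simp
    | add f g hf hg =>
      simp only [Finsupp.mapDomain_add]
      convert D.add_mem hf hg using 1
      abel
    | single x a =>
      simp only [Finsupp.mapDomain_single]
      exact h1 _ _ _ (hσ x).symm
  have e2 : Finsupp.mapDomain σ (Finsupp.mapDomain π f) ∈ D := by
    rw [Finsupp.mapDomain]
    refine D.sum_mem fun x _ => h2 _ _ ?_
    rw [← Phi_apply, hf]; rfl
  have := D.add_mem (e1 f) e2
  simpa using this

/-- kernel of the finite reduction -/
noncomputable def Z (a0 : AddSubgroup α) (N : Subgroup B) : AddSubgroup (B →₀ α) :=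
  (Phi (QuotientAddGroup.mk' a0) (QuotientGroup.mk : B → B ⧸ N)).ker

lemma Z_le {a0 : AddSubgroup α} {N : Subgroup B} {D : AddSubgroup (B →₀ α)}
    (h1 : ∀ x y a, x⁻¹ * y ∈ N → Finsupp.single x a - Finsupp.single y a ∈ D)
    (h2 : ∀ x, ∀ a ∈ a0, Finsupp.single x a ∈ D) : Z a0 N ≤ D := by
  intro f hf
  refine ker_le _ _ D (fun x y a h => h1 x y a (QuotientGroup.eq.1 h)) (fun x a h => h2 x a ?_) f hf
  simpa using h

lemma Z_single_sub {a0 : AddSubgroup α} {N : Subgroup B} {x y : B} (a : α) (h : x⁻¹ * y ∈ N) :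
    Finsupp.single x a - Finsupp.single y a ∈ Z a0 N := by
  have : (QuotientGroup.mk x : B ⧸ N) = QuotientGroup.mk y := QuotientGroup.eq.2 h
  simp [Z, AddMonoidHom.mem_ker, this]

lemma Z_single {a0 : AddSubgroup α} {N : Subgroup B} {x : B} {a : α} (h : a ∈ a0) :
    Finsupp.single x a ∈ Z a0 N := by
  have : (QuotientAddGroup.mk a : α ⧸ a0) = 0 := (QuotientAddGroup.eq_zero_iff _).2 h
  simp [Z, AddMonoidHom.mem_ker, this]

lemma Z_mono {a0 a1 : AddSubgroup α} {N M : Subgroup B} (h : a0 ≤ a1) (h' : N ≤ M) :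
    Z a0 N ≤ Z a1 M :=
  Z_le (fun _ _ a hx => Z_single_sub a (h' hx)) (fun _ _ ha => Z_single (h ha))

lemma Z_act_sub {a0 : AddSubgroup α} {N : Subgroup B} (hN : N.Normal) {c : B} (hc : c ∈ N)
    (f : B →₀ α) : act c f - f ∈ Z a0 N := by
  induction f using Finsupp.induction_linear with
  | zero => simp
  | add f g hf hg =>
    simp only [map_add]
    convert (Z a0 N).add_mem hf hg using 1
    abel
  | single x a =>
    rw [act_single]
    apply Z_single_sub
    have := hN.conj_mem _ (N.inv_mem hc) x⁻¹
    convert this using 1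
    group

lemma Z_act {a0 : AddSubgroup α} {N : Subgroup B} (c : B) {f : B →₀ α}
    (hf : f ∈ Z a0 N) : act c f ∈ Z a0 N := by
  have : Z a0 N ≤ (Z a0 N).comap (act c) := by
    refine Z_le ?_ ?_
    · intro x y a h
      simp only [AddSubgroup.mem_comap, map_sub, act_single]
      apply Z_single_sub
      convert h using 1
      group
    · intro x a h
      simp only [AddSubgroup.mem_comap, act_single]
      exact Z_single h
  exact this hf

/-- if `c ≡ d` mod `N` then `act c f ≡ act d f`. -/
lemma Z_act_congr {a0 : AddSubgroup α} {N : Subgroup B} (hN : N.Normal) {c d : B}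
    (hc : d⁻¹ * c ∈ N) (f : B →₀ α) : act c f - act d f ∈ Z a0 N := by
  have := Z_act (a0 := a0) d (Z_act_sub (a0 := a0) hN hc f)
  rw [map_sub, act_act] at this
  simpa using this

/-- coboundaries -/
noncomputable def D (b : B) : AddSubgroup (B →₀ α) := (act b - AddMonoidHom.id _).range

lemma mem_D {b : B} {f : B →₀ α} : f ∈ D b ↔ ∃ m, act b m - m = f := Iff.rfl

lemma D_zpow (b : B) (k : ℤ) (f : B →₀ α) : act (b ^ k) f - f ∈ D b := by
  have nat : ∀ (k : ℕ) (f : B →₀ α), act (b ^ k) f - f ∈ D b := by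
    intro k
    induction k with
    | zero => simp
    | succ k ih =>
      intro f
      have := (D b).add_mem (mem_D.2 ⟨act (b ^ k) f, rfl⟩) (ih f)
      convert this using 1
      rw [act_act, pow_succ']
      abel
  obtain ⟨n, rfl | rfl⟩ := k.eq_nat_or_neg
  · simpa using nat n f
  · have := (D b).neg_mem (nat n (act (b ^ (-(n : ℤ))) f))
    rw [act_act] at this
    simpa using this

lemma D_le_ker (b : B) {X β : Type*} [AddCommGroup β] (q : α →+ β) (π : B → X)
    (h : ∀ x, π (b * x) = π x) : D b ≤ (Phi q π).ker := by
  rintro _ ⟨m, rfl⟩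
  show Phi q π (act b m - m) = 0
  induction m using Finsupp.induction_linear with
  | zero => simp
  | add f g hf hg =>
    have : act b (f + g) - (f + g) = (act b f - f) + (act b g - g) := by rw [map_add]; abel
    rw [this, map_add, hf, hg, add_zero]
  | single x a => simp [h]

/-- right coset space -/
abbrev RC (H : Subgroup B) : Type u := Quotient (QuotientGroup.rightRel H)

/-- right coset map -/
def rc (H : Subgroup B) (x : B) : RC H := Quotient.mk _ x

lemma rc_eq {H : Subgroup B} {x y : B} : rc H x = rc H y ↔ y * x⁻¹ ∈ H := by
  rw [rc, rc, Quotient.eq, QuotientGroup.rightRel_apply]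

lemma mem_D_iff (b : B) (f : B →₀ α) :
    f ∈ D b ↔ Finsupp.mapDomain (rc (Subgroup.zpowers b)) f = 0 := by
  constructor
  · intro h
    have := D_le_ker b (AddMonoidHom.id α) (rc (Subgroup.zpowers b)) (fun x => by
      rw [rc_eq]; simp) h
    rw [AddMonoidHom.mem_ker] at this
    simpa [Phi] using this
  · intro h
    refine ker_le (AddMonoidHom.id α) (rc (Subgroup.zpowers b)) _ ?_ ?_ f ?_
    · intro x y a hxy
      rw [rc_eq] at hxy
      obtain ⟨k, hk⟩ := Subgroup.mem_zpowers_iff.1 hxy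
      have := (D b).neg_mem (D_zpow b k (Finsupp.single x a))
      simpa [hk] using this
    · intro x a ha
      have : a = 0 := ha
      simp [this]
    · simp [Phi, h]

lemma mapDomain_rc_apply [DecidableEq (B)] {X : Type*} [DecidableEq X] (π : B → X) (f : B →₀ α) (x : X) :
    Finsupp.mapDomain π f x = ∑ t ∈ f.support, if π t = x then f t else 0 := by
  simp [Finsupp.mapDomain, Finsupp.sum, Finsupp.finsetSum_apply, Finsupp.single_apply]

lemma DZ_le_ker (a1 : AddSubgroup α) {N : Subgroup B} (hNn : N.Normal) (b : B) : D b ⊔ Z a1 N ≤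
    (Phi (QuotientAddGroup.mk' a1) (rc (Subgroup.zpowers b ⊔ N))).ker := by
  refine sup_le (D_le_ker b _ _ ?_) (Z_le ?_ ?_)
  · intro x
    rw [rc_eq]
    refine Subgroup.mem_sup_left ?_
    simp
  · intro x y a h
    have : rc (Subgroup.zpowers b ⊔ N) x = rc (Subgroup.zpowers b ⊔ N) y := by
      rw [rc_eq]
      refine Subgroup.mem_sup_right (hNn.mem_comm h)
    simp [AddMonoidHom.mem_ker, this]
  · intro x a h
    have : (QuotientAddGroup.mk a : α ⧸ a1) = 0 := (QuotientAddGroup.eq_zero_iff _).2 h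
    simp [AddMonoidHom.mem_ker, this]

/-- separation of an element from coboundaries -/
lemma sepD (𝒜 : Set (AddSubgroup α)) (hres : ∀ a : α, a ≠ 0 → ∃ a0 ∈ 𝒜, a ∉ a0)
    (hne : ∃ N, N ∈ V.coC B)
    (hcyc : ∀ b : B, V.CSeparable ((Subgroup.zpowers b : Subgroup B) : Set B))
    (b : B) (f : B →₀ α) (hf : f ∉ D b) :
    ∃ a1 ∈ 𝒜, ∃ N ∈ V.coC B, f ∉ D b ⊔ Z a1 N := by
  classical
  rw [mem_D_iff] at hf
  obtain ⟨ξ, hξ⟩ := Finsupp.support_nonempty_iff.2 hf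
  have h2 := Finsupp.mapDomain_support hξ
  obtain ⟨s, hs, rfl⟩ := Finset.mem_image.1 h2
  rw [Finsupp.mem_support_iff] at hξ
  obtain ⟨a1, ha1, hna⟩ := hres _ hξ
  obtain ⟨N, hN, hsep⟩ := coC_fin (V := V) (G := B) (f.support : Set B) (Finset.finite_toSet _)
    (fun t N => t * s⁻¹ ∉ Subgroup.zpowers b → ∀ x ∈ Subgroup.zpowers b, ∀ n ∈ N, t * s⁻¹ ≠ x * n)
    hne (fun t N M h h1 h2 x hx n hn => h1 h2 x hx n (h hn)) (by
      intro t _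
      by_cases h : t * s⁻¹ ∈ Subgroup.zpowers b
      · obtain ⟨N, hN⟩ := hne
        exact ⟨N, hN, fun h' => absurd h h'⟩
      · obtain ⟨N, hN, h'⟩ := sep_iff _ (hcyc b) _ h
        exact ⟨N, hN, fun _ => h'⟩)
  refine ⟨a1, ha1, N, hN, ?_⟩
  have hNn := coC_normal hN
  intro hmem
  have hle := DZ_le_ker a1 hNn b
  have h0 := DFunLike.congr_fun (AddMonoidHom.mem_ker.1 (hle hmem)) (rc _ s)
  rw [Phi_apply, mapDomain_rc_apply] at h0
  rw [mapDomain_rc_apply] at hna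
  apply hna
  rw [← QuotientAddGroup.eq_zero_iff]
  refine Eq.trans ?_ h0
  refine congrArg (QuotientAddGroup.mk' a1) (Finset.sum_congr rfl fun t ht => ?_)
  refine if_congr ?_ rfl rfl
  rw [eq_comm, eq_comm (b := rc (Subgroup.zpowers b ⊔ N) s), rc_eq, rc_eq]
  constructor
  · exact fun h => Subgroup.mem_sup_left h
  · intro h
    by_contra hc
    obtain ⟨x, hx, n, hn, hxn⟩ := Subgroup.mem_sup_of_normal_right.1 h
    exact hsep t ht hc x hx n hn hxn.symm

lemma Phi_surj {X β : Type*} [AddCommGroup β] (q : α →+ β) (π : B → X)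
    (hq : Function.Surjective q) (hπ : Function.Surjective π) : Function.Surjective (Phi q π) := by
  intro f
  induction f using Finsupp.induction_linear with
  | zero => exact ⟨0, map_zero _⟩
  | add f g hf hg =>
    obtain ⟨f', rfl⟩ := hf
    obtain ⟨g', rfl⟩ := hg
    exact ⟨f' + g', map_add _ _ _⟩
  | single x a =>
    obtain ⟨x, rfl⟩ := hπ x
    obtain ⟨a, rfl⟩ := hq a
    exact ⟨Finsupp.single x a, Phi_single _ _ _ _⟩

lemma Phi_act {β : Type u} [AddCommGroup β] (q : α →+ β) (N : Subgroup B) [N.Normal] (c : B)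
    (f : B →₀ α) : Phi q (QuotientGroup.mk : B → B ⧸ N) (act c f) =
      act (QuotientGroup.mk c : B ⧸ N) (Phi q (QuotientGroup.mk : B → B ⧸ N) f) := by
  induction f using Finsupp.induction_linear with
  | zero => simp
  | add f g hf hg => simp only [map_add, hf, hg]
  | single x a => simp

/-- invariants are norms, free action -/
lemma norm_of_inv {Q : Type*} [Group Q] {β : Type*} [AddCommGroup β] (q : Q) (hq : IsOfFinOrder q)
    (w : Q →₀ β) (hw : ∀ x, w (q * x) = w x) :
    ∃ v : Q →₀ β, ∀ x, w x = ∑ i ∈ Finset.range (orderOf q), v ((q ^ i)⁻¹ * x) := by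
  classical
  let σ : Q → Q := fun x => (Quotient.mk (QuotientGroup.rightRel (Subgroup.zpowers q)) x).out
  have hσ : ∀ x, x * (σ x)⁻¹ ∈ Subgroup.zpowers q := by
    intro x
    have := Quotient.mk_out (s := QuotientGroup.rightRel (Subgroup.zpowers q)) x
    exact QuotientGroup.rightRel_apply.1 this
  have hσ2 : ∀ x (k : ℕ), σ ((q ^ k)⁻¹ * x) = σ x := by
    intro x k
    refine congrArg Quotient.out (Quotient.sound ?_)
    refine QuotientGroup.rightRel_apply.2 ?_
    simp
  have hwk : ∀ (k : ℕ) x, w (q ^ k * x) = w x := by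
    intro k
    induction k with
    | zero => simp
    | succ k ih => intro x; rw [pow_succ', mul_assoc, hw, ih]
  refine ⟨w.filter (fun x => σ x = x), fun x => ?_⟩
  obtain ⟨k, hk, hk2⟩ := Finset.mem_image.1 (hq.mem_zpowers_iff_mem_range_orderOf.1 (hσ x))
  have hk3 : σ x = (q ^ k)⁻¹ * x := by rw [hk2]; group
  rw [Finset.sum_eq_single k]
  · rw [Finsupp.filter_apply, if_pos (by rw [hσ2, hk3])]
    have := hwk k ((q ^ k)⁻¹ * x)
    rw [← this]; simp
  · intro i hi hik
    rw [Finsupp.filter_apply, if_neg]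
    rw [hσ2, hk3]
    intro h
    have h := inv_injective (mul_right_cancel h)
    exact hik (pow_injOn_Iio_orderOf (by simpa using hk) (by simpa using hi) h).symm
  · intro h
    exact absurd hk h

lemma zpow_sep (hcyc : ∀ b : B, V.CSeparable ((Subgroup.zpowers b : Subgroup B) : Set B))
    {N : Subgroup B} (hN : N ∈ V.coC B) (b : B) (n : ℕ) (hn : 0 < n) :
    ∃ M ∈ V.coC B, M ≤ N ∧ ∀ i : ℕ, b ^ i ∈ M → b ^ i ∈ Subgroup.zpowers (b ^ n) := by
  obtain ⟨M, hM, h⟩ := coC_fin (V := V) (G := B) (Set.Iio n) (Set.finite_Iio n)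
    (fun i M => b ^ i ∉ Subgroup.zpowers (b ^ n) →
      ∀ x ∈ Subgroup.zpowers (b ^ n), ∀ m ∈ M, b ^ i ≠ x * m)
    ⟨N, hN⟩ (fun t N M h h1 h2 x hx n hn => h1 h2 x hx n (h hn)) (by
      intro i _
      by_cases h : b ^ i ∈ Subgroup.zpowers (b ^ n)
      · exact ⟨N, hN, fun h' => absurd h h'⟩
      · obtain ⟨N, hN, h'⟩ := sep_iff _ (hcyc (b ^ n)) _ h
        exact ⟨N, hN, fun _ => h'⟩)
  refine ⟨M ⊓ N, coC_inf hM hN, inf_le_right, fun i hi => ?_⟩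
  have e : b ^ i = (b ^ n) ^ (i / n) * b ^ (i % n) := by
    rw [← pow_mul, ← pow_add, Nat.div_add_mod]
  have hp : (b ^ n) ^ (i / n) ∈ Subgroup.zpowers (b ^ n) :=
    Subgroup.pow_mem _ (Subgroup.mem_zpowers _) _
  have : b ^ (i % n) ∈ Subgroup.zpowers (b ^ n) := by
    by_contra hc
    refine h (i % n) (Nat.mod_lt _ hn) hc _ (inv_mem hp) _ hi.1 ?_
    rw [e]; group
  rw [e]
  exact mul_mem hp this

lemma Z_norm {a0 : AddSubgroup α} {N : Subgroup B} [hNn : N.Normal] (hN : N ∈ V.coC B) (b : B) (u : B →₀ α)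
    (hu : act b u - u ∈ Z a0 N) : ∃ v : B →₀ α,
      u - ∑ i ∈ Finset.range (orderOf (QuotientGroup.mk b : B ⧸ N)), act (b ^ i) v ∈ Z a0 N := by
  have hNf := coC_finite hN
  rw [Z, AddMonoidHom.mem_ker, map_sub, sub_eq_zero, Phi_act] at hu
  obtain ⟨v, hv⟩ := norm_of_inv (QuotientGroup.mk b : B ⧸ N) (isOfFinOrder_of_finite _)
    (Phi (QuotientAddGroup.mk' a0) (QuotientGroup.mk : B → B ⧸ N) u) (by
      intro x
      nth_rewrite 1 [← hu]
      rw [act_apply]; simp)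
  obtain ⟨v, rfl⟩ := Phi_surj (QuotientAddGroup.mk' a0) (QuotientGroup.mk : B → B ⧸ N)
    (QuotientAddGroup.mk'_surjective _) QuotientGroup.mk_surjective v
  refine ⟨v, ?_⟩
  rw [Z, AddMonoidHom.mem_ker, map_sub, sub_eq_zero, map_sum]
  ext x
  rw [hv, Finsupp.finsetSum_apply]
  refine Finset.sum_congr rfl fun i _ => ?_
  rw [Phi_act, act_apply]
  rfl

lemma sum_periodic {M : Type*} [AddCommGroup M] (F : ℕ → M) (o : ℕ) (hF : ∀ i, F (i + o) = F i)
    (t : ℕ) : ∑ i ∈ Finset.range (o * t), F i = t • ∑ i ∈ Finset.range o, F i := by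
  have hF2 : ∀ t i, F (o * t + i) = F i := by
    intro t
    induction t with
    | zero => simp
    | succ t ih => intro i; rw [← ih i, ← hF (o * t + i)]; congr 1; ring
  induction t with
  | zero => simp
  | succ t ih =>
    rw [Nat.mul_succ, Finset.sum_range_add, ih, succ_nsmul]
    congr 1
    exact Finset.sum_congr rfl fun i _ => hF2 t i

lemma Z_card_nsmul {a0 : AddSubgroup α} (N : Subgroup B) (f : B →₀ α) :
    Nat.card (α ⧸ a0) • f ∈ Z a0 N := by
  induction f using Finsupp.induction_linear with
  | zero => simp
  | add f g hf hg =>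
    rw [smul_add]; exact add_mem hf hg
  | single x a =>
    rw [Finsupp.smul_single]
    apply Z_single
    rw [← QuotientAddGroup.eq_zero_iff, QuotientAddGroup.mk_nsmul, card_nsmul_eq_zero']

/-- Step II -/
lemma inv_lift (hcyc : ∀ b : B, V.CSeparable ((Subgroup.zpowers b : Subgroup B) : Set B))
    (a0 : AddSubgroup α) [Finite (α ⧸ a0)] {N : Subgroup B} (hN : N ∈ V.coC B) (b : B) :
    ∃ M ∈ V.coC B, ∀ u : B →₀ α, act b u - u ∈ Z a0 M →
      ∃ w, act b w = w ∧ u - w ∈ Z a0 N := by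
  have hNn := coC_normal hN
  have hNf := coC_finite hN
  by_cases hb : IsOfFinOrder b
  · obtain ⟨M, hM, hMN, h⟩ := zpow_sep hcyc hN b (orderOf b) hb.orderOf_pos
    have hMn := coC_normal hM
    refine ⟨M, hM, fun u hu => ?_⟩
    obtain ⟨v, hv⟩ := Z_norm hM b u hu
    refine ⟨_, ?_, Z_mono le_rfl hMN hv⟩
    set o := orderOf (QuotientGroup.mk b : B ⧸ M)
    have ho : b ^ o = 1 := by
      have h1 : b ^ o ∈ M := by
        rw [← QuotientGroup.eq_one_iff, QuotientGroup.mk_pow, pow_orderOf_eq_one]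
      simpa [pow_orderOf_eq_one] using h o h1
    rw [← sub_eq_zero, map_sum, ← Finset.sum_sub_distrib]
    have := Finset.sum_range_sub (fun i => act (b ^ i) v) o
    simp only [ho, pow_zero, sub_self] at this
    rw [← this]
    refine Finset.sum_congr rfl fun i _ => ?_
    rw [act_act, pow_succ']
  · set o1 := orderOf (QuotientGroup.mk b : B ⧸ N)
    have ho1 : 0 < o1 := (isOfFinOrder_of_finite _).orderOf_pos
    have hbo : b ^ o1 ∈ N := by
      rw [← QuotientGroup.eq_one_iff, QuotientGroup.mk_pow, pow_orderOf_eq_one]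
    obtain ⟨M, hM, hMN, h⟩ := zpow_sep hcyc hN b (o1 * Nat.card (α ⧸ a0))
      (Nat.mul_pos ho1 Nat.card_pos)
    have hMn := coC_normal hM
    refine ⟨M, hM, fun u hu => ⟨0, map_zero _, ?_⟩⟩
    obtain ⟨v, hv⟩ := Z_norm hM b u hu
    have hv := Z_mono (le_refl a0) hMN hv
    set o := orderOf (QuotientGroup.mk b : B ⧸ M)
    have ho : b ^ o ∈ M := by
      rw [← QuotientGroup.eq_one_iff, QuotientGroup.mk_pow, pow_orderOf_eq_one]
    obtain ⟨k, hk⟩ := Subgroup.mem_zpowers_iff.1 (h o ho)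
    have hdvd : o1 * Nat.card (α ⧸ a0) ∣ o := by
      have hinj := injective_zpow_iff_not_isOfFinOrder.2 hb
      have : b ^ (((o1 * Nat.card (α ⧸ a0) : ℕ) : ℤ) * k) = b ^ (o : ℤ) := by
        rw [zpow_mul, zpow_natCast, hk, zpow_natCast]
      have := hinj this
      exact Int.natCast_dvd_natCast.1 ⟨k, this.symm⟩
    obtain ⟨t, ht⟩ := hdvd
    have key : ∑ i ∈ Finset.range o, act (b ^ i) v ∈ Z a0 N := by
      rw [Z, AddMonoidHom.mem_ker, map_sum, ht, mul_assoc, sum_periodic, ← map_sum, ← map_nsmul,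
        mul_nsmul]
      · exact nsmul_mem (S := Z a0 N) (Z_card_nsmul N _) t
      · intro i
        have := Z_act_congr (a0 := a0) hNn (c := b ^ (i + o1)) (d := b ^ i) (by
          rw [pow_add]; simpa using hbo) v
        rw [Z, AddMonoidHom.mem_ker, map_sub, sub_eq_zero] at this
        exact this
    have := add_mem hv key
    simpa using this

end modl
end WI

namespace WI
set_option linter.unusedSectionVars false
section modl2
variable {V : ECPseudoVariety.{u}} {B α : Type u} [Group B] [AddCommGroup α]

lemma fin_pair (𝒜 : Set (AddSubgroup α)) (hinf : ∀ a ∈ 𝒜, ∀ a' ∈ 𝒜, a ⊓ a' ∈ 𝒜)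
    {ι : Type*} (S : Set ι) (hS : S.Finite) (P : ι → AddSubgroup α → Subgroup B → Prop)
    (hne : ∃ N, N ∈ V.coC B) (hne' : ∃ a, a ∈ 𝒜)
    (hm : ∀ i a a' N M, a ≤ a' → N ≤ M → P i a' M → P i a N)
    (h : ∀ i ∈ S, ∃ a ∈ 𝒜, ∃ N ∈ V.coC B, P i a N) :
    ∃ a ∈ 𝒜, ∃ N ∈ V.coC B, ∀ i ∈ S, P i a N := by
  induction S, hS using Set.Finite.induction_on with
  | empty =>
    obtain ⟨N, hN⟩ := hne
    obtain ⟨a, ha⟩ := hne'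
    exact ⟨a, ha, N, hN, by simp⟩
  | @insert i s _ _ ih =>
    obtain ⟨a, ha, N, hN, h1⟩ := ih (fun i hi => h i (Set.mem_insert_of_mem _ hi))
    obtain ⟨a', ha', M, hM, h2⟩ := h i (Set.mem_insert _ _)
    refine ⟨a ⊓ a', hinf _ ha _ ha', N ⊓ M, coC_inf hN hM, ?_⟩
    rintro j (rfl | hi)
    · exact hm _ _ _ _ _ inf_le_right inf_le_right h2
    · exact hm _ _ _ _ _ inf_le_left inf_le_left (h1 j hi)

lemma stepI (𝒜 : Set (AddSubgroup α)) (hinf : ∀ a ∈ 𝒜, ∀ a' ∈ 𝒜, a ⊓ a' ∈ 𝒜)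
    (hne' : ∃ a, a ∈ 𝒜)
    (hres : ∀ a : α, a ≠ 0 → ∃ a0 ∈ 𝒜, a ∉ a0)
    (hresB : V.Residually B)
    (hcyc : ∀ b : B, V.CSeparable ((Subgroup.zpowers b : Subgroup B) : Set B))
    {b b' : B} (hP : P V b b') (f f' : B →₀ α) {N : Subgroup B} (hN : N ∈ V.coC B) :
    ∃ a1 ∈ 𝒜, ∃ N1 ∈ V.coC B, ∀ m c, c * b * c⁻¹ * b'⁻¹ ∈ N1 →
      m - act b' m + act c f - f' ∈ Z a1 N1 →
      ∃ c', c' * b * c'⁻¹ = b' ∧ c'⁻¹ * c ∈ N ∧ act c' f - f' ∈ D b' := by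
  classical
  have hne : ∃ N, N ∈ V.coC B := ⟨N, hN⟩
  by_cases hf : f ∈ D b
  · obtain ⟨m0, rfl⟩ := mem_D.1 hf
    by_cases hf' : f' ∈ D b'
    · obtain ⟨N1, hN1, h⟩ := hP N hN
      obtain ⟨a, ha⟩ := hne'
      refine ⟨a, ha, N1, hN1, fun m c hc _ => ?_⟩
      obtain ⟨t, ht, htc⟩ := h c hc
      refine ⟨t, ht, htc, (D b').sub_mem ?_ hf'⟩
      refine mem_D.2 ⟨act t m0, ?_⟩
      rw [map_sub, act_act, act_act, ← ht]
      simp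
    · obtain ⟨a1, ha1, N1, hN1, h⟩ := sepD (V := V) 𝒜 hres hne hcyc b' f' hf'
      refine ⟨a1, ha1, N1, hN1, fun m c hc hZ => ?_⟩
      exfalso
      apply h
      have hn := coC_normal hN1
      have h1 : act (c * b) m0 - act (b' * c) m0 ∈ Z a1 N1 := by
        refine Z_act_congr hn ?_ _
        have := hn.conj_mem _ hc (b' * c)⁻¹
        convert this using 1
        group
      have h2 : act b' (act c m0 - m) - (act c m0 - m) ∈ D b' := mem_D.2 ⟨_, rfl⟩
      have h3 := (Z a1 N1).sub_mem h1 hZ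
      have := AddSubgroup.add_mem_sup h2 h3
      convert this using 1
      simp only [map_sub, act_act]
      abel
  · obtain ⟨a1, ha1, N1, hN1, h1⟩ := sepD (V := V) 𝒜 hres hne hcyc b f hf
    obtain ⟨a2, ha2, N2, hN2, h2⟩ := fin_pair (V := V) (B := B) 𝒜 hinf
      (Set.image2 (fun x' x => x' * x⁻¹) (f'.support : Set B) (f.support : Set B))
      (Set.Finite.image2 _ (Finset.finite_toSet _) (Finset.finite_toSet _))
      (fun d a N => (act d f - f' ∉ D b' → act d f - f' ∉ D b' ⊔ Z a N) ∧
        (d * b * d⁻¹ * b'⁻¹ ≠ 1 → d * b * d⁻¹ * b'⁻¹ ∉ N)) hne hne'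
      (fun d a a' N M ha hN h => ⟨fun h1 h2 => h.1 h1 (sup_le_sup le_rfl (Z_mono ha hN) h2),
        fun h1 h2 => h.2 h1 (hN h2)⟩) (by
      intro d _
      have e1 : ∃ a ∈ 𝒜, ∃ N ∈ V.coC B, (act d f - f' ∉ D b' → act d f - f' ∉ D b' ⊔ Z a N) := by
        by_cases h : act d f - f' ∈ D b'
        · exact ⟨a1, ha1, N, hN, fun h' => absurd h h'⟩
        · obtain ⟨a, ha, N, hN, h⟩ := sepD (V := V) 𝒜 hres hne hcyc b' _ h
          exact ⟨a, ha, N, hN, fun _ => h⟩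
      have e2 : ∃ N ∈ V.coC B, (d * b * d⁻¹ * b'⁻¹ ≠ 1 → d * b * d⁻¹ * b'⁻¹ ∉ N) := by
        by_cases h : d * b * d⁻¹ * b'⁻¹ = 1
        · exact ⟨N, hN, fun h' => absurd h h'⟩
        · obtain ⟨N, hN, h⟩ := hresB _ h
          exact ⟨N, hN, fun _ => h⟩
      obtain ⟨a, ha, N, hN, e1⟩ := e1
      obtain ⟨M, hM, e2⟩ := e2
      exact ⟨a, ha, N ⊓ M, coC_inf hN hM,
        fun h1 h2 => e1 h1 (sup_le_sup le_rfl (Z_mono le_rfl inf_le_left) h2),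
        fun h1 h2 => e2 h1 h2.2⟩)
    refine ⟨a1 ⊓ a2, hinf _ ha1 _ ha2, N1 ⊓ N2 ⊓ N, coC_inf (coC_inf hN1 hN2) hN, ?_⟩
    intro m c hc hZ
    have hMn : (N1 ⊓ N2 ⊓ N).Normal := coC_normal (coC_inf (coC_inf hN1 hN2) hN)
    have l1 : N1 ⊓ N2 ⊓ N ≤ N1 := inf_le_left.trans inf_le_left
    have l2 : N1 ⊓ N2 ⊓ N ≤ N2 := inf_le_left.trans inf_le_right
    have l3 : N1 ⊓ N2 ⊓ N ≤ N := inf_le_right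
    generalize N1 ⊓ N2 ⊓ N = M at *
    have r1 : a1 ⊓ a2 ≤ a1 := inf_le_left
    have r2 : a1 ⊓ a2 ≤ a2 := inf_le_right
    generalize a1 ⊓ a2 = a at *
    have hcf : act c f - f' ∈ D b' ⊔ Z a M := by
      have h2 : act b' m - m ∈ D b' := mem_D.2 ⟨_, rfl⟩
      have := AddSubgroup.add_mem_sup h2 hZ
      convert this using 1
      abel
    -- find matching support elements
    have hmatch : ∃ x ∈ f.support, ∃ x' ∈ f'.support,
        rc (Subgroup.zpowers b' ⊔ M) x' = rc (Subgroup.zpowers b' ⊔ M) (c * x) := by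
      by_contra hcon
      push Not at hcon
      apply h1
      refine sup_le_sup le_rfl (Z_mono r1 l1) ?_
      refine ker_le (QuotientAddGroup.mk' a) (fun x => rc (Subgroup.zpowers b' ⊔ M) (c * x)) _
        ?_ ?_ f ?_
      · intro x y s hxy
        rw [rc_eq] at hxy
        obtain ⟨_, hx, n, hn, hxn⟩ := Subgroup.mem_sup_of_normal_left.1 (sup_comm _ M ▸ hxy)
        obtain ⟨k, rfl⟩ := Subgroup.mem_zpowers_iff.1 hn
        -- c y (c x)⁻¹ = n b'^k
        have hy : (b ^ k * x)⁻¹ * y ∈ M := by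
          rw [← QuotientGroup.eq] 
          have e1 := (QuotientGroup.eq_one_iff _).2 hx
          have e2 := (QuotientGroup.eq_one_iff _).2 hc
          have e3 := congrArg (QuotientGroup.mk : B → B ⧸ M) hxn
          simp only [QuotientGroup.mk_mul, QuotientGroup.mk_inv, QuotientGroup.mk_zpow] at *
          rw [e1, one_mul] at e3
          have e4 := mul_inv_eq_one.1 e2
          rw [← e4, conj_zpow] at e3
          rw [eq_mul_inv_iff_mul_eq] at e3
          simpa [mul_assoc] using e3
        have h1 := (D b).neg_mem (D_zpow b k (Finsupp.single x s))
        have h2 := Z_single_sub (a0 := a) s hy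
        have := AddSubgroup.add_mem_sup h1 h2
        convert this using 1
        rw [act_single]
        abel
      · intro x s hs
        refine (le_sup_right : Z a M ≤ _) (Z_single ?_)
        simpa using hs
      · have e0 : Phi (QuotientAddGroup.mk' a) (fun x => rc (Subgroup.zpowers b' ⊔ M) (c * x)) f =
            Phi (QuotientAddGroup.mk' a) (rc (Subgroup.zpowers b' ⊔ M)) (act c f) := by
          clear * -
          induction f using Finsupp.induction_linear with
          | zero => simp
          | add f g hf hg => simp only [map_add, hf, hg]
          | single x a => simp
        have e1 := AddMonoidHom.mem_ker.1 (DZ_le_ker a hMn b' hcf)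
        rw [map_sub, sub_eq_zero, ← e0] at e1
        ext ξ
        by_contra hne
        have hne2 : Phi (QuotientAddGroup.mk' a) (rc (Subgroup.zpowers b' ⊔ M)) f' ξ ≠ 0 := by
          rw [← e1]; exact hne
        rw [Phi_apply] at hne hne2
        have i1 := Finsupp.mapDomain_support (Finsupp.mem_support_iff.2
          (fun h => hne (by rw [h]; exact map_zero _)))
        have i2 := Finsupp.mapDomain_support (Finsupp.mem_support_iff.2
          (fun h => hne2 (by rw [h]; exact map_zero _)))
        obtain ⟨x, hx, hx2⟩ := Finset.mem_image.1 i1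
        obtain ⟨x', hx', hx2'⟩ := Finset.mem_image.1 i2
        exact hcon x hx x' hx' (hx2'.trans hx2.symm)
    obtain ⟨x, hx, x', hx', hxx⟩ := hmatch
    rw [rc_eq] at hxx
    obtain ⟨_, hk, n, hn, hkn⟩ := Subgroup.mem_sup_of_normal_right.1 hxx
    obtain ⟨k, rfl⟩ := Subgroup.mem_zpowers_iff.1 hk
    obtain ⟨h3, h4⟩ := h2 (x' * x⁻¹) ⟨x', hx', x, hx, rfl⟩
    generalize hd : x' * x⁻¹ = d at *
    have hcd : (b' ^ k * d)⁻¹ * c ∈ M := by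
      have : c = b' ^ k * n * d := by rw [hkn, ← hd]; group
      have h5 := hMn.conj_mem _ hn d⁻¹
      convert h5 using 1
      rw [this]; group
    have hdT : d * b * d⁻¹ * b'⁻¹ = 1 := by
      by_contra hcon
      apply h4 hcon (l2 _)
      rw [← QuotientGroup.eq] at hcd
      rw [← QuotientGroup.eq_one_iff] at hc ⊢
      simp only [QuotientGroup.mk_mul, QuotientGroup.mk_inv, QuotientGroup.mk_zpow] at *
      rw [← hcd] at hc
      have e := mul_inv_eq_one.1 hc
      rw [mul_inv_eq_one]
      have : ∀ u v w : B ⧸ M, u * v * w * (u * v)⁻¹ = u * (v * w * v⁻¹) * u⁻¹ := by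
        intro u v w; group
      rw [this] at e
      have e' : (b' : B ⧸ M) ^ k * b' * ((b' : B ⧸ M) ^ k)⁻¹ = b' := by
        rw [(Commute.zpow_self (b' : B ⧸ M) k).eq]; group
      have e := e.trans e'.symm
      exact mul_left_cancel (mul_right_cancel e)
    rw [mul_inv_eq_one] at hdT
    refine ⟨b' ^ k * d, ?_, l3 hcd, ?_⟩
    · have : b' ^ k * d * b * (b' ^ k * d)⁻¹ = b' ^ k * (d * b * d⁻¹) * (b' ^ k)⁻¹ := by group
      rw [this, hdT, (Commute.zpow_self b' k).eq]; group
    · have e1 := D_zpow b' k (act d f)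
      rw [act_act] at e1
      have e2 : act d f - f' ∈ D b' := by
        by_contra hcon
        apply h3 hcon
        refine sup_le_sup le_rfl (Z_mono r2 l2) ?_
        have e3 := Z_act_congr (a0 := a) hMn hcd f
        have e4 := AddSubgroup.add_mem_sup e1 e3
        have := AddSubgroup.sub_mem _ hcf e4
        convert this using 1
        abel
      have := add_mem e1 e2
      simpa using this

end modl2
end WI

namespace WI
set_option linter.unusedSectionVars false
section wr
variable {V : ECPseudoVariety.{u}} {A B : Type u} [CommGroup A] [Group B]

/-- base element as a finsupp -/
noncomputable def fs (f : WreathBase A B) : B →₀ Additive A :=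
  ⟨(show (Function.mulSupport (f : B → A)).Finite from f.2).toFinset,
    fun x => Additive.ofMul ((f : B → A) x), by
    intro x
    rw [Set.Finite.mem_toFinset, Function.mem_mulSupport]
    exact Iff.rfl⟩

lemma fs_apply (f : WreathBase A B) (x : B) : fs f x = Additive.ofMul ((f : B → A) x) := rfl

/-- finsupp as a base element -/
noncomputable def sf (m : B →₀ Additive A) : WreathBase A B :=
  ⟨fun x => (m x).toMul, by
    refine m.support.finite_toSet.subset ?_
    intro x hx
    rw [Finset.mem_coe, Finsupp.mem_support_iff]
    exact hx⟩

@[simp] lemma fs_sf (m : B →₀ Additive A) : fs (sf m) = m := by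
  ext x; rfl

@[simp] lemma sf_fs (f : WreathBase A B) : sf (fs f) = f := by
  apply Subtype.ext; rfl

lemma fs_inj {f g : WreathBase A B} (h : fs f = fs g) : f = g := by
  rw [← sf_fs f, h, sf_fs]

@[simp] lemma fs_mul (f g : WreathBase A B) : fs (f * g) = fs f + fs g := by
  ext x; rfl

@[simp] lemma fs_one : fs (1 : WreathBase A B) = 0 := by
  ext x; rfl

@[simp] lemma fs_inv (f : WreathBase A B) : fs f⁻¹ = - fs f := by
  ext x; rfl

@[simp] lemma fs_act (c : B) (f : WreathBase A B) :
    fs (wreathAction A B c f) = act c (fs f) := by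
  ext x
  rw [act_apply]; rfl

lemma fs_comm (z g y : RWreath A B) : fs (z * g * z⁻¹ * y⁻¹).left =
    fs z.left + act z.right (fs g.left) - act (z.right * g.right * z.right⁻¹) (fs z.left)
      - act (z.right * g.right * z.right⁻¹ * y.right⁻¹) (fs y.left) := by
  simp [SemidirectProduct.mul_left, -map_inv, act_act, sub_eq_add_neg, mul_assoc, add_assoc]

/-- the standard open subgroups -/
noncomputable def Lr (a0 : AddSubgroup (Additive A)) (N : Subgroup B) :
    Subgroup (RWreath A B) where
  carrier := {z | fs z.left ∈ Z a0 N ∧ z.right ∈ N}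
  one_mem' := by simp
  mul_mem' := by
    rintro z w ⟨h1, h2⟩ ⟨h3, h4⟩
    refine ⟨?_, N.mul_mem h2 h4⟩
    rw [SemidirectProduct.mul_left, fs_mul, fs_act]
    exact add_mem h1 (Z_act _ h3)
  inv_mem' := by
    rintro z ⟨h1, h2⟩
    refine ⟨?_, N.inv_mem h2⟩
    rw [SemidirectProduct.inv_left, fs_act, fs_inv]
    exact Z_act _ (neg_mem h1)

lemma mem_Lr {a0 : AddSubgroup (Additive A)} {N : Subgroup B} {z : RWreath A B} :
    z ∈ Lr a0 N ↔ fs z.left ∈ Z a0 N ∧ z.right ∈ N := Iff.rfl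

lemma Lr_normal {a0 : AddSubgroup (Additive A)} {N : Subgroup B} (hN : N.Normal) :
    (Lr a0 N).Normal := by
  constructor
  rintro z ⟨h1, h2⟩ w
  have h := fs_comm w z 1
  simp only [inv_one, mul_one, SemidirectProduct.one_left, fs_one, map_zero, sub_zero,
    SemidirectProduct.one_right] at h
  have h3 := hN.conj_mem _ h2 w.right
  refine ⟨?_, h3⟩
  rw [h]
  have := sub_mem (Z_act w.right h1) (Z_act_sub (a0 := a0) hN h3 (fs w.left))
  convert this using 1
  abel

/-- open subgroups of the abelian group, additively -/
def AA (V : ECPseudoVariety.{u}) (A : Type u) [CommGroup A] : Set (AddSubgroup (Additive A)) :=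
  {a0 | ∃ A0 ∈ V.coC A, ∀ a : Additive A, a ∈ a0 ↔ a.toMul ∈ A0}

lemma AA_inf : ∀ a ∈ AA V A, ∀ a' ∈ AA V A, a ⊓ a' ∈ AA V A := by
  rintro a ⟨A0, h0, h⟩ a' ⟨A1, h1, h'⟩
  refine ⟨A0 ⊓ A1, coC_inf h0 h1, fun x => ?_⟩
  rw [AddSubgroup.mem_inf, Subgroup.mem_inf, h, h']

lemma AA_of {A0 : Subgroup A} (h : A0 ∈ V.coC A) : Subgroup.toAddSubgroup A0 ∈ AA V A :=
  ⟨A0, h, fun _ => Iff.rfl⟩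

lemma AA_mem {a0 : AddSubgroup (Additive A)} (h : a0 ∈ AA V A) :
    V.mem (Multiplicative (Additive A ⧸ a0)) := by
  obtain ⟨A0, ⟨hn, hA⟩, h⟩ := h
  let φ : A →* Multiplicative (Additive A ⧸ a0) :=
    { toFun := fun a => Multiplicative.ofAdd (QuotientAddGroup.mk (Additive.ofMul a))
      map_one' := rfl
      map_mul' := fun _ _ => rfl }
  refine mem_of_surj (QuotientGroup.lift A0 φ ?_) ?_ hA
  · intro a ha
    exact (QuotientAddGroup.eq_zero_iff _).2 ((h _).2 ha)
  · intro x
    obtain ⟨y, hy⟩ := QuotientAddGroup.mk_surjective (Multiplicative.toAdd x)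
    exact ⟨QuotientGroup.mk y.toMul, hy⟩

lemma Lr_coC {a0 : AddSubgroup (Additive A)} (ha : a0 ∈ AA V A) {N : Subgroup B}
    (hN : N ∈ V.coC B) : Lr a0 N ∈ V.coC (RWreath A B) := by
  have hn := coC_normal hN
  have hfin := coC_finite hN
  let ψ : (N.comap (SemidirectProduct.rightHom (φ := wreathAction A B))) →*
      Multiplicative ((B ⧸ N) →₀ (Additive A ⧸ a0)) :=
    { toFun := fun z => Multiplicative.ofAdd (Phi (QuotientAddGroup.mk' a0)
        (QuotientGroup.mk : B → B ⧸ N) (fs (z : RWreath A B).left))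
      map_one' := by simp
      map_mul' := by
        rintro ⟨z, hz⟩ ⟨w, hw⟩
        rw [← ofAdd_add, ← map_add]
        congr 1
        rw [← sub_eq_zero, ← map_sub]
        have := Z_act_sub (a0 := a0) hn hz (fs w.left)
        refine Eq.trans (congrArg _ ?_) this
        simp }
  refine coC_ext (coC_comap SemidirectProduct.rightHom hN) (Lr_normal hn) (fun z hz => hz.2) ψ ?_ ?_
  · refine mem_of_inj (H := (B ⧸ N) → Multiplicative (Additive A ⧸ a0))
      ⟨⟨fun f x => Multiplicative.ofAdd (Multiplicative.toAdd f x), rfl⟩, fun _ _ => rfl⟩ ?_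
      (mem_pi _ (AA_mem ha))
    intro f g h
    apply Multiplicative.toAdd.injective
    ext x
    exact congrFun h x
  · intro k hk
    exact ⟨hk, k.2⟩

lemma sf_act (c : B) (m : B →₀ Additive A) :
    (SemidirectProduct.inl (sf (act c m)) : RWreath A B) =
      SemidirectProduct.inr c * SemidirectProduct.inl (sf m) * SemidirectProduct.inr c⁻¹ := by
  rw [← SemidirectProduct.inl_aut]
  congr 1
  apply fs_inj
  simp

lemma sf_add (m n : B →₀ Additive A) : sf (m + n) = sf m * sf n := by
  apply fs_inj; simp

lemma sf_zero : sf (0 : B →₀ Additive A) = 1 := by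
  apply fs_inj; simp

lemma sf_neg (m : B →₀ Additive A) : sf (-m) = (sf m)⁻¹ := by
  apply fs_inj; simp

/-- base part of a subgroup -/
noncomputable def DK (K : Subgroup (RWreath A B)) : AddSubgroup (B →₀ Additive A) where
  carrier := {m | (SemidirectProduct.inl (sf m) : RWreath A B) ∈ K}
  zero_mem' := by
    show SemidirectProduct.inl (sf 0) ∈ K
    rw [sf_zero, map_one]; exact K.one_mem
  add_mem' := by
    intro m n hm hn
    show SemidirectProduct.inl (sf _) ∈ K
    rw [sf_add, map_mul]; exact K.mul_mem hm hn
  neg_mem' := by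
    intro m hm
    show SemidirectProduct.inl (sf _) ∈ K
    rw [sf_neg, map_inv]; exact K.inv_mem hm

lemma mem_DK {K : Subgroup (RWreath A B)} {m : B →₀ Additive A} :
    m ∈ DK K ↔ (SemidirectProduct.inl (sf m) : RWreath A B) ∈ K := Iff.rfl

/-- embedding of A at a coordinate -/
noncomputable def emb (x : B) : A →* RWreath A B where
  toFun a := SemidirectProduct.inl (sf (Finsupp.single x (Additive.ofMul a)))
  map_one' := by simp [sf_zero]
  map_mul' a b := by rw [← map_mul, ← sf_add, ← Finsupp.single_add]; rfl

lemma DK_sub {K : Subgroup (RWreath A B)} (hK : K.Normal) {n : B}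
    (hn : (SemidirectProduct.inr n : RWreath A B) ∈ K) (m : B →₀ Additive A) :
    m - act n m ∈ DK K := by
  rw [mem_DK, sub_eq_add_neg, sf_add, sf_neg, map_mul, map_inv, sf_act]
  have h1 := hK.conj_mem _ hn (SemidirectProduct.inl (sf m))
  have := K.mul_mem h1 (K.inv_mem hn)
  convert this using 1
  rw [map_inv]; group

lemma cofinal {K : Subgroup (RWreath A B)} (hK : K ∈ V.coC (RWreath A B)) :
    ∃ a0 ∈ AA V A, ∃ N ∈ V.coC B, Lr a0 N ≤ K := by
  have hKn := coC_normal hK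
  refine ⟨_, AA_of (coC_comap (emb 1) hK), _, coC_comap SemidirectProduct.inr hK, ?_⟩
  rintro z ⟨h1, h2⟩
  have hle : Z (Subgroup.toAddSubgroup (K.comap (emb 1)))
      (K.comap (SemidirectProduct.inr : B →* RWreath A B)) ≤ DK K := by
    refine Z_le ?_ ?_
    · intro x y a h
      have h' : y * x⁻¹ ∈ K.comap (SemidirectProduct.inr : B →* RWreath A B) :=
        Subgroup.Normal.mem_comm inferInstance h
      have := DK_sub hKn h' (Finsupp.single x a)
      simpa using this
    · intro x a ha
      have ha : (SemidirectProduct.inl (sf (Finsupp.single 1 a)) : RWreath A B) ∈ K := ha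
      have : Finsupp.single x a = act x (Finsupp.single 1 a) := by simp
      rw [this, mem_DK, sf_act, map_inv]
      exact hKn.conj_mem _ ha _
  have h3 := hle h1
  rw [mem_DK, sf_fs] at h3
  have := K.mul_mem h3 h2
  rwa [SemidirectProduct.inl_left_mul_inr_right] at this

/-- Main lemma -/
lemma main (hresA : V.Residually A) (hresB : V.Residually B)
    (hcyc : ∀ b : B, V.CSeparable ((Subgroup.zpowers b : Subgroup B) : Set B))
    (g y : RWreath A B) (hP : P V g.right y.right) : P V g y := by
  intro K hK
  obtain ⟨a0, ha0, N, hN, hNK⟩ := cofinal hK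
  have hfin : Finite (Additive A ⧸ a0) := V.finite (Multiplicative (Additive A ⧸ a0)) (AA_mem ha0)
  obtain ⟨M, hM, hlift⟩ := inv_lift hcyc a0 hN y.right
  have hMn := coC_normal hM
  have hres : ∀ a : Additive A, a ≠ 0 → ∃ a0 ∈ AA V A, a ∉ a0 := by
    intro a ha
    obtain ⟨A0, h0, h1⟩ := hresA a.toMul ha
    exact ⟨_, AA_of h0, h1⟩
  obtain ⟨a1, ha1, N1, hN1, h1⟩ := stepI (AA V A) AA_inf ⟨a0, ha0⟩ hres hresB hcyc hP
    (fs g.left) (fs y.left) (coC_inf hN hM)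
  have hL : N1 ⊓ M ∈ V.coC B := coC_inf hN1 hM
  have hLn := coC_normal hL
  refine ⟨Lr (a1 ⊓ a0) (N1 ⊓ M), Lr_coC (AA_inf _ ha1 _ ha0) hL, ?_⟩
  intro z hz
  rw [mem_Lr, fs_comm] at hz
  obtain ⟨hz1, hz2⟩ := hz
  have hz2 : z.right * g.right * z.right⁻¹ * y.right⁻¹ ∈ N1 ⊓ M := hz2
  have hz3 : fs z.left - act y.right (fs z.left) + act z.right (fs g.left) - fs y.left
      ∈ Z (a1 ⊓ a0) (N1 ⊓ M) := by
    have e1 := Z_act_sub (a0 := a1 ⊓ a0) hLn hz2 (fs y.left)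
    have e2 := Z_act_sub (a0 := a1 ⊓ a0) hLn hz2 (act y.right (fs z.left))
    rw [act_act, inv_mul_cancel_right] at e2
    have := add_mem (add_mem hz1 e1) e2
    convert this using 1
    abel
  obtain ⟨c, hc1, hc2, hc3⟩ := h1 _ _ hz2.1 (Z_mono inf_le_left inf_le_left hz3)
  obtain ⟨m0, hm0⟩ := mem_D.1 hc3
  have hz4 := Z_mono (inf_le_right : a1 ⊓ a0 ≤ a0) (inf_le_right : N1 ⊓ M ≤ M) hz3
  obtain ⟨w, hw1, hw2⟩ := hlift (fs z.left - m0) (by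
    have e1 := Z_act_congr (a0 := a0) hMn hc2.2 (fs g.left)
    have := sub_mem e1 hz4
    convert this using 1
    have : act y.right m0 = m0 + (act c (fs g.left) - fs y.left) := by rw [← hm0]; abel
    rw [map_sub, this]
    abel)
  let t : RWreath A B := ⟨sf (m0 + w), c⟩
  have ht1 : t.right = c := rfl
  have ht2 : fs t.left = m0 + w := fs_sf _
  refine ⟨t, ?_, hNK ?_⟩
  · rw [← mul_inv_eq_one]
    refine SemidirectProduct.ext ?_ ?_
    · apply fs_inj
      rw [fs_comm, ht1, ht2, hc1, mul_inv_cancel, act_one, map_add, hw1]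
      have : act y.right m0 = m0 + (act c (fs g.left) - fs y.left) := by rw [← hm0]; abel
      rw [this, SemidirectProduct.one_left, fs_one]
      abel
    · show c * g.right * c⁻¹ * y.right⁻¹ = 1
      rw [hc1, mul_inv_cancel]
  · refine mem_Lr.2 ⟨?_, hc2.1⟩
    rw [SemidirectProduct.mul_left, SemidirectProduct.inv_left, fs_mul, fs_act, fs_inv, fs_act,
      SemidirectProduct.inv_right, ht1, ht2, ← map_add]
    refine Z_act _ ?_
    convert hw2 using 1
    abel

/-- cyclic subgroups of B are separable -/
lemma cyc_of (hA : Nontrivial A) (h : V.ConjSep (RWreath A B)) (b : B) :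
    V.CSeparable ((Subgroup.zpowers b : Subgroup B) : Set B) := by
  intro x hx
  obtain ⟨a, ha⟩ := exists_ne (1 : A)
  let m : B →₀ Additive A := Finsupp.single 1 (Additive.ofMul a) - Finsupp.single x (Additive.ofMul a)
  obtain ⟨L, hL, hsep⟩ := h (SemidirectProduct.inr b) (SemidirectProduct.inl (sf m) *
      SemidirectProduct.inr b) (by
    intro hc
    obtain ⟨z, hz⟩ := isConj_iff.1 hc
    rw [← mul_inv_eq_one] at hz
    have hr := congrArg SemidirectProduct.right hz
    have hl := congrArg (fun w => fs w.left) hz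
    simp only [fs_comm] at hl
    simp only [SemidirectProduct.mul_right, SemidirectProduct.inv_right, SemidirectProduct.right_inl,
      SemidirectProduct.right_inr, SemidirectProduct.one_right, one_mul] at hr
    simp only [SemidirectProduct.left_inr, SemidirectProduct.right_inr, SemidirectProduct.mul_left,
      SemidirectProduct.right_inl, SemidirectProduct.left_inl, SemidirectProduct.mul_right,
      one_mul, hr, SemidirectProduct.one_left, map_one, mul_one, fs_one, map_zero, act_one,
      fs_sf] at hl
    rw [mul_inv_eq_one.1 hr] at hl
    have hm : m ∈ D b := by
      refine mem_D.2 ⟨- fs z.left, ?_⟩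
      have : m = fs z.left + 0 - act b (fs z.left) := by
        rw [eq_comm, ← sub_eq_zero]; exact hl
      rw [this, map_neg]; abel
    rw [mem_D_iff] at hm
    have h1 := DFunLike.congr_fun hm (rc (Subgroup.zpowers b) 1)
    have hne : rc (Subgroup.zpowers b) x ≠ rc (Subgroup.zpowers b) 1 := by
      rw [Ne, eq_comm, rc_eq]; simpa using hx
    have hms : Finsupp.mapDomain (rc (Subgroup.zpowers b)) m =
        Finsupp.single (rc (Subgroup.zpowers b) 1) (Additive.ofMul a) -
          Finsupp.single (rc (Subgroup.zpowers b) x) (Additive.ofMul a) := by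
      have := map_sub (Finsupp.mapDomain.addMonoidHom (rc (Subgroup.zpowers b)))
        (Finsupp.single 1 (Additive.ofMul a)) (Finsupp.single x (Additive.ofMul a))
      simpa using this
    rw [hms] at h1
    simp [Finsupp.single_apply, hne] at h1
    exact ha h1)
  have hLn := coC_normal hL
  rw [conjSep_iff _ _ _ hLn] at hsep
  refine ⟨L.comap SemidirectProduct.inr, coC_comap _ hL, ?_⟩
  rintro ⟨y, hy, hyx⟩
  apply hsep
  have hyx := QuotientGroup.eq.1 hyx
  obtain ⟨k, rfl⟩ := Subgroup.mem_zpowers_iff.1 hy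
  -- single 1 a - single (b^k) a ∈ D b
  obtain ⟨w, hw⟩ := mem_D.1 (D_zpow b k (Finsupp.single 1 (Additive.ofMul a)))
  have hn : x * (b ^ k)⁻¹ ∈ L.comap (SemidirectProduct.inr : B →* RWreath A B) :=
    Subgroup.Normal.mem_comm inferInstance hyx
  have h1 := DK_sub hLn hn (Finsupp.single (b ^ k) (Additive.ofMul a))
  rw [act_single, inv_mul_cancel_right] at h1
  refine ⟨SemidirectProduct.inl (sf w), ?_⟩
  have h2 := (DK L).neg_mem h1
  rw [mem_DK] at h2
  convert h2 using 1
  rw [← mul_inv_eq_one]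
  refine SemidirectProduct.ext ?_ ?_
  · apply fs_inj
    have e : m = Finsupp.single (b ^ k) (Additive.ofMul a) - (act b w - w) -
        Finsupp.single x (Additive.ofMul a) := by
      rw [hw]; simp [m]
    rw [SemidirectProduct.mul_left, fs_mul, fs_comm, fs_act]
    simp [e]
    abel
  · simp

end wr

section back
variable {V : ECPseudoVariety.{u}} {A B : Type u} [Group A] [Group B]

lemma retract {b b' : B} (h : P V (SemidirectProduct.inr b : RWreath A B) (SemidirectProduct.inr b')) :
    P V b b' := by
  intro K hK
  obtain ⟨L, hL, h⟩ := h _ (coC_comap SemidirectProduct.rightHom hK)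
  refine ⟨L.comap SemidirectProduct.inr, coC_comap _ hL, fun z hz => ?_⟩
  obtain ⟨t, ht, htz⟩ := h (SemidirectProduct.inr z) (by
    simpa only [Subgroup.mem_comap, map_mul, map_inv] using hz)
  refine ⟨t.right, ?_, ?_⟩
  · simpa using congrArg SemidirectProduct.right ht
  · simpa using htz

open Classical in
/-- single coordinate -/
noncomputable def sg (x : B) : A →* WreathBase A B where
  toFun a := ⟨fun y => if y = x then a else 1, (Set.finite_singleton x).subset (by
    intro y hy
    by_contra h
    exact hy (if_neg h))⟩
  map_one' := by
    apply Subtype.ext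
    funext y
    show (if y = x then (1 : A) else 1) = 1
    simp
  map_mul' a b := by
    apply Subtype.ext
    funext y
    show (if y = x then a * b else 1) = (if y = x then a else 1) * (if y = x then b else 1)
    split_ifs <;> simp

open Classical in
lemma sg_apply (x y : B) (a : A) : (sg x a).1 y = if y = x then a else 1 := rfl

lemma sg_inj (x : B) : Function.Injective (sg (A := A) x) := by
  intro a b h
  have := congrFun (congrArg Subtype.val h) x
  simpa [sg_apply] using this

lemma sg_comm {x y : B} (h : x ≠ y) (a b : A) : Commute (sg x a) (sg y b) := by
  apply Subtype.ext
  funext z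
  show (sg x a).1 z * (sg y b).1 z = (sg y b).1 z * (sg x a).1 z
  rw [sg_apply, sg_apply]
  by_cases h1 : z = x
  · have h2 : z ≠ y := h1 ▸ h
    simp [h2]
  · simp [h1]

lemma sg_act (c : B) (a : A) : wreathAction A B c (sg 1 a) = sg c a := by
  apply Subtype.ext
  funext x
  show (sg 1 a).1 (c⁻¹ * x) = (sg c a).1 x
  rw [sg_apply, sg_apply]
  have : c⁻¹ * x = 1 ↔ x = c := by rw [inv_mul_eq_one, eq_comm]
  by_cases h : x = c
  · rw [if_pos h, if_pos (this.2 h)]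
  · rw [if_neg h, if_neg (fun h' => h (this.1 h'))]

lemma comm_of_res [Infinite B] (h : V.Residually (RWreath A B)) (a a' : A) : a * a' = a' * a := by
  by_contra hne
  let i : A →* RWreath A B := SemidirectProduct.inl.comp (sg 1)
  have hi : Function.Injective i := SemidirectProduct.inl_injective.comp (sg_inj 1)
  obtain ⟨N, hN, hnot⟩ := h (i (a * a' * (a' * a)⁻¹)) (by
    rw [Ne, map_eq_one_iff i hi, mul_inv_eq_one]; exact hne)
  have hNn := coC_normal hN
  have hf := coC_finite (coC_comap (SemidirectProduct.inr : B →* RWreath A B) hN)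
  obtain ⟨x, y, hxy, he⟩ := Finite.exists_ne_map_eq_of_infinite
    (QuotientGroup.mk : B → B ⧸ (N.comap (SemidirectProduct.inr : B →* RWreath A B)))
  have hn := QuotientGroup.eq.1 he
  have hn1 : 1 ≠ x⁻¹ * y := by
    intro h; exact hxy (inv_mul_eq_one.1 h.symm)
  generalize x⁻¹ * y = n at hn hn1
  have hn : (SemidirectProduct.inr n : RWreath A B) ∈ N := hn
  have e : (SemidirectProduct.inl (sg n a') : RWreath A B) =
      SemidirectProduct.inr n * i a' * (SemidirectProduct.inr n)⁻¹ := by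
    rw [← sg_act, SemidirectProduct.inl_aut, map_inv]; rfl
  have e2 : i a * SemidirectProduct.inl (sg n a') = SemidirectProduct.inl (sg n a') * i a := by
    show SemidirectProduct.inl _ * _ = _ * SemidirectProduct.inl _
    rw [← map_mul, ← map_mul, (sg_comm hn1 a a').eq]
  rw [e] at e2
  apply hnot
  rw [← QuotientGroup.eq_one_iff] at hn ⊢
  have e3 := congrArg (QuotientGroup.mk : _ → RWreath A B ⧸ N) e2
  simp only [QuotientGroup.mk_mul, QuotientGroup.mk_inv, hn, map_mul, map_inv, one_mul, inv_one,
    mul_one] at e3 ⊢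
  rw [mul_inv_eq_one]
  exact e3

end back
end WI

/-- (1) If `A`, `B` are residually-`𝒞`, `A` is abelian, `B` is infinite,
`B` satisfies the `𝒞`-centralizer condition and all cyclic subgroups of `B` are
`𝒞`-separable, then `A ≀ B` satisfies the `𝒞`-centralizer condition.
(2) For `A` nontrivial and `B` infinite, `A ≀ B` is `𝒞`-HCS iff `A` is abelian and
residually-`𝒞`, and `B` is `𝒞`-HCS with all cyclic subgroups `𝒞`-separable. -/
theorem wreath_infinite_acting (V : ECPseudoVariety.{u}) :
    (∀ (A B : Type u) [Group A] [Group B],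
        V.Residually A → V.Residually B → (∀ x y : A, x * y = y * x) → Infinite B →
        V.SatisfiesCC B →
        (∀ b : B, V.CSeparable ((Subgroup.zpowers b : Subgroup B) : Set B)) →
        V.SatisfiesCC (RWreath A B)) ∧
    (∀ (A B : Type u) [Group A] [Group B], Nontrivial A → Infinite B →
      (V.HCS (RWreath A B) ↔
        ((∀ x y : A, x * y = y * x) ∧ V.Residually A) ∧
        (V.HCS B ∧ ∀ b : B, V.CSeparable ((Subgroup.zpowers b : Subgroup B) : Set B)))) := by
  constructor
  · intro A B iA iB hA hB hcomm _ hCC hcyc g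
    letI : CommGroup A := { iA with mul_comm := hcomm }
    exact WI.CC_of_P g (WI.main hA hB hcyc g g (WI.P_of_CC _ (hCC _)))
  · intro A B iA iB hA hB
    constructor
    · intro h
      have hres := WI.res_of_conjSep h.1
      have hcomm : ∀ x y : A, x * y = y * x := WI.comm_of_res hres
      letI : CommGroup A := { iA with mul_comm := hcomm }
      have hresA : V.Residually A := WI.res_of_inj (SemidirectProduct.inl.comp (WI.sg (1 : B)))
        (SemidirectProduct.inl_injective.comp (WI.sg_inj 1)) hres
      obtain ⟨a, ha⟩ := exists_ne (1 : A)
      obtain ⟨N, hN, _⟩ := hresA a ha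
      refine ⟨⟨hcomm, hresA⟩, ?_, WI.cyc_of hA h.1⟩
      exact WI.HCS_of_P (fun b b' => WI.retract (A := A) (WI.P_of_HCS h _ _)) ⟨_, WI.coC_top_of hN⟩
    · rintro ⟨⟨hcomm, hresA⟩, hB', hcyc⟩
      letI : CommGroup A := { iA with mul_comm := hcomm }
      have hresB := WI.res_of_conjSep hB'.1
      obtain ⟨a, ha⟩ := exists_ne (1 : A)
      obtain ⟨N, hN, _⟩ := hresA a ha
      exact WI.HCS_of_P (fun g y => WI.main hresA hresB hcyc g y (WI.P_of_HCS hB' _ _))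
        ⟨_, WI.coC_top_of hN⟩
end

section
/- Let p be a prime and suppose that A and B are p-hereditarily conjugacy separable groups with A nontrivial. Then A ≀ B is p-hereditarily conjugacy separable if and only if at least one of the following holds: (1) B is a finite p-group; or (2) A is abelian and B is a p-group (every element of B has order a power of p). -/
open Pointwise

universe u

lemma pCoC_iff {p : ℕ} {G : Type u} [Group G] {N : Subgroup G} :
    N ∈ pCoC p G ↔ N.Normal ∧ Finite (G ⧸ N) ∧ ∀ g : G, ∃ k : ℕ, g ^ p ^ k ∈ N := by
  constructor
  · rintro ⟨hN, hf, hp⟩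
    refine ⟨hN, hf, fun g => ?_⟩
    obtain ⟨k, hk⟩ := hp (QuotientGroup.mk g)
    exact ⟨k, by rwa [← QuotientGroup.mk_pow, QuotientGroup.eq_one_iff] at hk⟩
  · rintro ⟨hN, hf, hp⟩
    refine ⟨hN, hf, fun g => ?_⟩
    induction g using QuotientGroup.induction_on with
    | H g =>
      obtain ⟨k, hk⟩ := hp g
      exact ⟨k, by rwa [← QuotientGroup.mk_pow, QuotientGroup.eq_one_iff]⟩

lemma ker_mem_pCoC {p : ℕ} {G : Type u} [Group G] {P : Type*} [Group P] [Finite P]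
    (hP : IsPGroup p P) (φ : G →* P) : φ.ker ∈ pCoC p G := by
  rw [pCoC_iff]
  refine ⟨inferInstance, ?_, fun g => ?_⟩
  · exact Finite.of_equiv _ (QuotientGroup.quotientKerEquivRange φ).symm.toEquiv
  · obtain ⟨k, hk⟩ := hP (φ g)
    exact ⟨k, by rw [MonoidHom.mem_ker, map_pow, hk]⟩

lemma pCoC_comap {p : ℕ} {G : Type u} {H : Type*} [Group G] [Group H] (φ : G →* H)
    {N : Subgroup H} (hN : N.Normal) (hf : Finite (H ⧸ N)) (hp : IsPGroup p (H ⧸ N)) :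
    N.comap φ ∈ pCoC p G := by
  have := ker_mem_pCoC hp ((QuotientGroup.mk' N).comp φ)
  rwa [← MonoidHom.comap_ker, QuotientGroup.ker_mk'] at this

lemma pCoC_comap' {p : ℕ} {G : Type u} {H : Type u} [Group G] [Group H] (φ : G →* H)
    {N : Subgroup H} (hN : N ∈ pCoC p H) : N.comap φ ∈ pCoC p G := by
  obtain ⟨h1, h2, h3⟩ := hN
  exact pCoC_comap φ h1 h2 h3

lemma top_mem_pCoC {p : ℕ} {G : Type u} [Group G] : (⊤ : Subgroup G) ∈ pCoC p G := by
  rw [pCoC_iff]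
  exact ⟨inferInstance, inferInstance, fun g => ⟨0, trivial⟩⟩

lemma inf_mem_pCoC {p : ℕ} {G : Type u} [Group G] {M N : Subgroup G}
    (hM : M ∈ pCoC p G) (hN : N ∈ pCoC p G) : M ⊓ N ∈ pCoC p G := by
  rw [pCoC_iff] at *
  obtain ⟨h1, h2, h3⟩ := hM
  obtain ⟨h4, h5, h6⟩ := hN
  refine ⟨inferInstance, ?_, fun g => ?_⟩
  · have := Subgroup.finiteIndex_of_finite_quotient (H := M)
    have := Subgroup.finiteIndex_of_finite_quotient (H := N)
    exact Subgroup.finite_quotient_of_finiteIndex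
  · obtain ⟨a, ha⟩ := h3 g
    obtain ⟨b, hb⟩ := h6 g
    refine ⟨a + b, ?_, ?_⟩
    · rw [pow_add, pow_mul]; exact M.pow_mem ha _
    · rw [pow_add, mul_comm, pow_mul]; exact N.pow_mem hb _

lemma finset_inf_mem_pCoC {p : ℕ} {G : Type u} [Group G] {ι : Type*} (s : Finset ι)
    (f : ι → Subgroup G) (hf : ∀ i, f i ∈ pCoC p G) : s.inf f ∈ pCoC p G := by
  classical
  induction s using Finset.induction_on with
  | empty => simpa using top_mem_pCoC
  | insert a s _ ih => rw [Finset.inf_insert]; exact inf_mem_pCoC (hf a) ih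

/-- pigeonhole principle along the directed system of `p`-open normal subgroups -/
lemma pigeon {p : ℕ} {G : Type u} [Group G] {ι : Type*} [Finite ι]
    (P : ι → Subgroup G → Prop) (hmono : ∀ i L L', L' ≤ L → P i L' → P i L)
    (h : ∀ L ∈ pCoC p G, ∃ i, P i L) : ∃ i, ∀ L ∈ pCoC p G, P i L := by
  by_contra hc
  push Not at hc
  choose L hL hLP using hc
  cases nonempty_fintype ι
  obtain ⟨i, hi⟩ := h _ (finset_inf_mem_pCoC Finset.univ L hL)
  exact hLP i (hmono i _ _ (Finset.inf_le (Finset.mem_univ i)) hi)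

/-- closedness of the `K`-conjugacy class of `x`, at `y` -/
def GoodAt (p : ℕ) {G : Type u} [Group G] (x y : G) (K : Subgroup G) : Prop :=
  (∀ L ∈ pCoC p G, ∃ k ∈ K, k * x * k⁻¹ * y⁻¹ ∈ L) → ∃ k ∈ K, k * x * k⁻¹ = y

def Good (p : ℕ) (G : Type u) [Group G] : Prop :=
  ∀ x y : G, ∀ K ∈ pCoC p G, GoodAt p x y K

lemma goodAt_of_le {p : ℕ} {G : Type u} [Group G] {x : G} {K K' : Subgroup G}
    (hK' : K' ∈ pCoC p G) (hle : K' ≤ K) (h : ∀ y, GoodAt p x y K') (y : G) :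
    GoodAt p x y K := by
  intro H
  have hfin : Finite (G ⧸ K') := hK'.2.1
  obtain ⟨q, hq⟩ := pigeon (p := p) (G := G) (ι := G ⧸ K')
    (fun q L => ∃ k ∈ K, k * x * k⁻¹ * y⁻¹ ∈ L ∧ (QuotientGroup.mk k : G ⧸ K') = q)
    (by rintro i L L' hL ⟨k, h1, h2, h3⟩; exact ⟨k, h1, hL h2, h3⟩)
    (fun L hL => by obtain ⟨k, h1, h2⟩ := H L hL; exact ⟨_, k, h1, h2, rfl⟩)
  obtain ⟨t, ht, -, htq⟩ := hq ⊤ top_mem_pCoC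
  obtain ⟨k, hk, hky⟩ := h (t⁻¹ * y * t) (fun L hL => by
    obtain ⟨k, h1, h2, h3⟩ := hq L hL
    have hn : L.Normal := hL.1
    refine ⟨t⁻¹ * k, ?_, ?_⟩
    · rw [← htq] at h3
      exact QuotientGroup.eq.1 h3.symm
    · have := hn.conj_mem _ h2 t⁻¹
      convert this using 1
      group)
  refine ⟨t * k, K.mul_mem ht (hle hk), ?_⟩
  have : y = t * (t⁻¹ * y * t) * t⁻¹ := by group
  rw [this, ← hky]; group

lemma exists_pCoC_le_map {p : ℕ} (hpp : p.Prime) {G : Type u} [Group G] {H : Subgroup G}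
    (hH : pOpen p H) {M : Subgroup H} (hM : M ∈ pCoC p H) :
    ∃ L ∈ pCoC p G, L ≤ M.map H.subtype := by
  obtain ⟨N, hN, hNH⟩ := hH
  rw [pCoC_iff] at hN
  obtain ⟨hNn, hNf, hNp⟩ := hN
  obtain ⟨hMn, hMf, hMp⟩ := hM
  have i1 := Subgroup.finiteIndex_of_finite_quotient (H := N)
  have i2 := Subgroup.finiteIndex_of_finite_quotient (H := M)
  have i3 : H.FiniteIndex := Subgroup.finiteIndex_of_le hNH
  have i4 : (M.map H.subtype).FiniteIndex := by
    constructor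
    rw [Subgroup.index_map_subtype]
    exact mul_ne_zero i2.1 i3.1
  refine ⟨N ⊓ (M.map H.subtype).normalCore, ?_, inf_le_right.trans (Subgroup.normalCore_le _)⟩
  rw [pCoC_iff]
  refine ⟨inferInstance, Subgroup.finite_quotient_of_finiteIndex, fun g => ?_⟩
  have := Fact.mk hpp
  obtain ⟨a, ha⟩ := hNp g
  obtain ⟨b, hb⟩ := IsPGroup.iff_card.1 hMp
  refine ⟨a + b, ?_, ?_⟩
  · rw [pow_add, pow_mul]; exact N.pow_mem ha _
  · intro t
    have h1 : t * g ^ p ^ a * t⁻¹ ∈ N := hNn.conj_mem _ ha t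
    rw [pow_add, pow_mul, ← conj_pow]
    refine ⟨⟨_, hNH h1⟩ ^ p ^ b, ?_, rfl⟩
    have : (QuotientGroup.mk (⟨_, hNH h1⟩ : H) : H ⧸ M) ^ p ^ b = 1 := by
      rw [← hb]; exact pow_card_eq_one'
    rwa [← QuotientGroup.mk_pow, QuotientGroup.eq_one_iff] at this

lemma conj_mk_of {G : Type u} [Group G] {N : Subgroup G} [N.Normal] {x y k : G}
    (h : k * x * k⁻¹ * y⁻¹ ∈ N) :
    IsConj (QuotientGroup.mk x : G ⧸ N) (QuotientGroup.mk y) := by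
  rw [isConj_iff]
  refine ⟨QuotientGroup.mk k, ?_⟩
  have := (QuotientGroup.eq_one_iff _).2 h
  rw [QuotientGroup.mk_mul, mul_eq_one_iff_eq_inv, QuotientGroup.mk_inv, inv_inv] at this
  exact this

lemma exists_of_conj_mk {G : Type u} [Group G] {N : Subgroup G} [N.Normal] {x y : G}
    (h : IsConj (QuotientGroup.mk x : G ⧸ N) (QuotientGroup.mk y)) :
    ∃ k : G, k * x * k⁻¹ * y⁻¹ ∈ N := by
  rw [isConj_iff] at h
  obtain ⟨c, hc⟩ := h
  obtain ⟨k, rfl⟩ := QuotientGroup.mk_surjective c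
  refine ⟨k, (QuotientGroup.eq_one_iff _).1 ?_⟩
  rw [QuotientGroup.mk_mul, mul_eq_one_iff_eq_inv, QuotientGroup.mk_inv, inv_inv]
  exact hc

lemma good_of_pHCS {p : ℕ} (hp : p.Prime) {G : Type u} [Group G] (h : pHCS p G) :
    Good p G := by
  intro x y K hK hyp
  have hKn : K.Normal := hK.1
  have hHo : pOpen p (K ⊔ Subgroup.zpowers x) := ⟨K, hK, le_sup_left⟩
  have hx : x ∈ K ⊔ Subgroup.zpowers x :=
    Subgroup.mem_sup_right (Subgroup.mem_zpowers x)
  have hKH : ∀ k ∈ K, k ∈ K ⊔ Subgroup.zpowers x := fun k hk => Subgroup.mem_sup_left hk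
  have hy : y ∈ K ⊔ Subgroup.zpowers x := by
    obtain ⟨k, hk, hk2⟩ := hyp K hK
    have := (K ⊔ Subgroup.zpowers x).mul_mem
      ((K ⊔ Subgroup.zpowers x).inv_mem (hKH _ hk2))
      ((K ⊔ Subgroup.zpowers x).mul_mem ((K ⊔ Subgroup.zpowers x).mul_mem (hKH _ hk) hx)
        ((K ⊔ Subgroup.zpowers x).inv_mem (hKH _ hk)))
    convert this using 1
    group
  by_cases hc : IsConj (⟨x, hx⟩ : ↥(K ⊔ Subgroup.zpowers x)) ⟨y, hy⟩
  · rw [isConj_iff] at hc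
    obtain ⟨⟨c, hcm⟩, hc⟩ := hc
    have hc' : c * x * c⁻¹ = y := congrArg Subtype.val hc
    obtain ⟨k, hk, z, hz, rfl⟩ := Subgroup.mem_sup_of_normal_left.1 hcm
    obtain ⟨i, rfl⟩ := Subgroup.mem_zpowers_iff.1 hz
    refine ⟨k, hk, ?_⟩
    rw [← hc']
    group
  · exfalso
    obtain ⟨M, hM, hMn, hnc⟩ := h.2 _ hHo _ _ hc
    obtain ⟨L, hL, hLM⟩ := exists_pCoC_le_map hp hHo hM
    obtain ⟨k, hk, hk2⟩ := hyp L hL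
    apply hnc
    obtain ⟨m, hm, hme⟩ := hLM hk2
    refine conj_mk_of (k := ⟨k, hKH k hk⟩) ?_
    have he : m = ⟨k, hKH k hk⟩ * ⟨x, hx⟩ * ⟨k, hKH k hk⟩⁻¹ * ⟨y, hy⟩⁻¹ := Subtype.ext hme
    rw [← he]
    exact hm

lemma pHCS_of_good {p : ℕ} {G : Type u} [Group G] (h : Good p G) : pHCS p G := by
  refine ⟨fun x y hxy => ?_, fun H hH x y hxy => ?_⟩
  · by_contra hc
    apply hxy
    obtain ⟨k, -, hk⟩ := h x y ⊤ top_mem_pCoC (fun L hL => by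
      by_contra hc2
      refine hc ⟨L, hL, hL.1, fun hcc => hc2 ?_⟩
      obtain ⟨k, hk⟩ := @exists_of_conj_mk _ _ L hL.1 _ _ hcc
      exact ⟨k, trivial, hk⟩)
    exact isConj_iff.2 ⟨k, hk⟩
  · obtain ⟨N, hN, hNH⟩ := hH
    by_contra hc
    apply hxy
    obtain ⟨k, hkH, hk⟩ := goodAt_of_le hN hNH (fun y => h x y N hN) (y : G) (fun L hL => by
      by_contra hc2
      have hL' : L.comap H.subtype ∈ pCoC p H := pCoC_comap' _ hL
      refine hc ⟨L.comap H.subtype, hL', hL'.1, fun hcc => hc2 ?_⟩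
      obtain ⟨k, hk⟩ := @exists_of_conj_mk _ _ _ hL'.1 _ _ hcc
      exact ⟨k, k.2, hk⟩)
    exact isConj_iff.2 ⟨⟨k, hkH⟩, Subtype.ext hk⟩

lemma resid_of_pConjSep {p : ℕ} {G : Type u} [Group G] (h : pConjSep p G) {g : G}
    (hg : g ≠ 1) : ∃ N ∈ pCoC p G, g ∉ N := by
  obtain ⟨N, hN, hNn, hc⟩ := h g 1 (fun hc => hg (isConj_one_left.1 hc))
  refine ⟨N, hN, fun hgN => hc ?_⟩
  rw [(QuotientGroup.eq_one_iff g).2 hgN]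
  exact IsConj.refl _

/-! ### basic wreath product facts -/

section wreath
variable {A B : Type u} [Group A] [Group B]

open Classical in
noncomputable def bsingle (s : B) : A →* WreathBase A B where
  toFun a := ⟨Pi.mulSingle s a, by
    refine (Set.finite_singleton s).subset ?_
    exact Pi.mulSupport_mulSingle_subset⟩
  map_one' := Subtype.ext (Pi.mulSingle_one s)
  map_mul' a b := Subtype.ext (Pi.mulSingle_mul (f := fun _ : B => A) s a b)

lemma wfin (f : WreathBase A B) : (Function.mulSupport (f : B → A)).Finite := f.2

lemma bsingle_same (s : B) (a : A) : (bsingle s a : B → A) s = a := by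
  simp [bsingle]

lemma bsingle_ne {s t : B} (h : t ≠ s) (a : A) : (bsingle s a : B → A) t = 1 := by
  simp [bsingle, h]

open Classical in
lemma bsingle_apply (s t : B) (a : A) : (bsingle s a : B → A) t = if t = s then a else 1 := by
  split_ifs with h
  · subst h; exact bsingle_same _ _
  · exact bsingle_ne h a

lemma wact_apply (c : B) (f : WreathBase A B) (s : B) :
    (wreathAction A B c f : B → A) s = (f : B → A) (c⁻¹ * s) := rfl

lemma wact_bsingle (c s : B) (a : A) :
    wreathAction A B c (bsingle s a) = bsingle (c * s) a := by
  classical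
  apply Subtype.ext
  funext t
  rw [wact_apply, bsingle_apply, bsingle_apply]
  simp only [inv_mul_eq_iff_eq_mul]

lemma wmul_left (x y : RWreath A B) (s : B) :
    ((x * y).left : B → A) s = (x.left : B → A) s * (y.left : B → A) (x.right⁻¹ * s) := rfl

lemma wbase_mem (H : Subgroup (WreathBase A B)) (f : WreathBase A B)
    (h : ∀ s, bsingle s ((f : B → A) s) ∈ H) : f ∈ H := by
  classical
  obtain ⟨n, hn⟩ : ∃ n, n = (wfin f).toFinset.card := ⟨_, rfl⟩
  induction n generalizing f with
  | zero =>
    have h0 : (wfin f).toFinset = ∅ := Finset.card_eq_zero.1 hn.symm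
    have : f = 1 := by
      apply Subtype.ext
      funext s
      by_contra hs
      have : s ∈ (wfin f).toFinset := by
        rw [Set.Finite.mem_toFinset]; exact hs
      rw [h0] at this
      simp at this
    rw [this]; exact H.one_mem
  | succ n ih =>
    obtain ⟨s, hs⟩ : (wfin f).toFinset.Nonempty := by
      rw [← Finset.card_pos, ← hn]; exact Nat.succ_pos _
    have hval : ∀ t, (((bsingle s ((f : B → A) s))⁻¹ * f : WreathBase A B) : B → A) t =
        if t = s then 1 else (f : B → A) t := by
      intro t
      change ((bsingle s ((f : B → A) s) : B → A) t)⁻¹ * (f : B → A) t = _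
      rw [bsingle_apply]
      split_ifs with hts
      · subst hts; simp
      · simp
    have hsub : (wfin ((bsingle s ((f : B → A) s))⁻¹ * f : WreathBase A B)).toFinset
        = (wfin f).toFinset.erase s := by
      ext t
      rw [Finset.mem_erase, Set.Finite.mem_toFinset, Set.Finite.mem_toFinset,
        Function.mem_mulSupport, Function.mem_mulSupport, hval]
      split_ifs with hts <;> simp [hts]
    have h2 := ih ((bsingle s ((f : B → A) s))⁻¹ * f) (fun t => by
      rw [hval]
      split_ifs
      · rw [map_one]; exact H.one_mem
      · exact h t) (by
        rw [hsub, Finset.card_erase_of_mem hs, ← hn]; rfl)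
    have := H.mul_mem (h s) h2
    rwa [mul_inv_cancel_left] at this

lemma inr_inl_inr (c : B) (f : WreathBase A B) :
    (SemidirectProduct.inr c * SemidirectProduct.inl f * (SemidirectProduct.inr c)⁻¹ :
      RWreath A B) = SemidirectProduct.inl (wreathAction A B c f) := by
  rw [SemidirectProduct.inl_aut, map_inv]

lemma inl_bsingle_mem {K : Subgroup (RWreath A B)} (hK : K.Normal) {a : A}
    (h : (SemidirectProduct.inl (bsingle 1 a) : RWreath A B) ∈ K) (s : B) :
    (SemidirectProduct.inl (bsingle s a) : RWreath A B) ∈ K := by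
  have := hK.conj_mem _ h (SemidirectProduct.inr s)
  rwa [inr_inl_inr, wact_bsingle, mul_one] at this

lemma inl_mem_of_forall {K : Subgroup (RWreath A B)} (hK : K.Normal) (f : WreathBase A B)
    (h : ∀ s, (SemidirectProduct.inl (bsingle 1 ((f : B → A) s)) : RWreath A B) ∈ K) :
    (SemidirectProduct.inl f : RWreath A B) ∈ K := by
  have := wbase_mem (K.comap SemidirectProduct.inl) f (fun s => inl_bsingle_mem hK (h s) s)
  exact this

lemma eq_inl_of_right {x : RWreath A B} (h : x.right = 1) :
    x = SemidirectProduct.inl x.left := by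
  ext1
  · simp
  · simpa using h

/-- Conjugation by a base element. -/
lemma inl_conj {x y : RWreath A B} (hr : x.right = y.right) (h : WreathBase A B)
    (hh : ∀ s, (h : B → A) s * (x.left : B → A) s =
      (y.left : B → A) s * (h : B → A) (x.right⁻¹ * s)) :
    SemidirectProduct.inl h * x * (SemidirectProduct.inl h)⁻¹ = y := by
  rw [mul_inv_eq_iff_eq_mul]
  refine SemidirectProduct.ext (Subtype.ext (funext fun s => ?_)) ?_
  · rw [wmul_left, wmul_left]
    simp only [SemidirectProduct.left_inl, SemidirectProduct.right_inl, inv_one, one_mul]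
    rw [hh, hr]
  · simp [hr]

lemma wright_pow (x : RWreath A B) (n : ℕ) : (x ^ n).right = x.right ^ n :=
  map_pow SemidirectProduct.rightHom x n

lemma wpow_succ_left (x : RWreath A B) (i : ℕ) (s : B) :
    ((x ^ (i + 1)).left : B → A) s =
      ((x ^ i).left : B → A) s * (x.left : B → A) ((x.right ^ i)⁻¹ * s) := by
  rw [pow_succ, wmul_left, wright_pow]

lemma transport {x y : RWreath A B} {b : B} (hx : x.right = b) (hy : y.right = b) {n : ℕ}
    (hn : b ^ n = 1) (ι : B → ℕ)
    (hι : ∀ s, ι (b⁻¹ * s) = ι s + 1 ∨ (ι s + 1 = n ∧ ι (b⁻¹ * s) = 0))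
    (h0 : B → A)
    (hh0 : ∀ s, h0 s * ((x ^ n).left : B → A) s = ((y ^ n).left : B → A) s * h0 s)
    (h : B → A)
    (hh : ∀ s, h s = (((y ^ ι s).left : B → A) (b ^ ι s * s))⁻¹ * h0 (b ^ ι s * s) *
      ((x ^ ι s).left : B → A) (b ^ ι s * s)) (s : B) :
    h s * (x.left : B → A) s = (y.left : B → A) s * h (b⁻¹ * s) := by
  have key : h s * (x.left : B → A) s = (y.left : B → A) s *
      ((((y ^ (ι s + 1)).left : B → A) (b ^ ι s * s))⁻¹ * h0 (b ^ ι s * s) *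
      ((x ^ (ι s + 1)).left : B → A) (b ^ ι s * s)) := by
    rw [hh s, wpow_succ_left, wpow_succ_left, hx, hy, inv_mul_cancel_left]
    group
  rw [key]
  congr 1
  rw [hh (b⁻¹ * s)]
  rcases hι s with h1 | ⟨h1, h2⟩
  · rw [h1]
    have : b ^ (ι s + 1) * (b⁻¹ * s) = b ^ ι s * s := by rw [pow_succ]; group
    rw [this]
  · have hr : b ^ ι s * s = b⁻¹ * s := by
      rw [← mul_left_inj (s⁻¹)]
      have : b ^ ι s * b = 1 := by rw [← pow_succ, h1, hn]
      rw [mul_inv_cancel_right, mul_inv_cancel_right, eq_inv_of_mul_eq_one_left this]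
    rw [h1, h2, hr, mul_assoc, hh0]
    simp

lemma exists_iota (b : B) (n : ℕ) (hn : orderOf b = n) (hpos : 0 < n) :
    ∃ ι : B → ℕ, ∀ s, ι s < n ∧
      (ι (b⁻¹ * s) = ι s + 1 ∨ (ι s + 1 = n ∧ ι (b⁻¹ * s) = 0)) := by
  classical
  let r : B → B := fun s => (Quotient.mk (QuotientGroup.rightRel (Subgroup.zpowers b)) s).out
  have hr : ∀ s, r (b⁻¹ * s) = r s := by
    intro s
    have : Quotient.mk (QuotientGroup.rightRel (Subgroup.zpowers b)) (b⁻¹ * s) =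
      Quotient.mk (QuotientGroup.rightRel (Subgroup.zpowers b)) s := by
      apply Quotient.sound
      change QuotientGroup.rightRel _ _ _
      rw [QuotientGroup.rightRel_apply]
      simp
    change Quotient.out _ = Quotient.out _
    rw [this]
  have hex : ∀ s, ∃ i, i < n ∧ b ^ i * s = r s := by
    intro s
    have h1 : QuotientGroup.rightRel (Subgroup.zpowers b) s (r s) :=
      Setoid.symm' _ (Quotient.mk_out (s := QuotientGroup.rightRel (Subgroup.zpowers b)) s)
    rw [QuotientGroup.rightRel_apply] at h1
    have hfin : IsOfFinOrder b := orderOf_pos_iff.1 (hn ▸ hpos)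
    obtain ⟨i, hi⟩ := (hfin.mem_powers_iff_mem_zpowers).2 h1
    refine ⟨i % n, Nat.mod_lt _ hpos, ?_⟩
    rw [← hn, pow_mod_orderOf]
    have hi : b ^ i = r s * s⁻¹ := hi
    rw [hi]; group
  choose ι hι1 hι2 using hex
  refine ⟨ι, fun s => ⟨hι1 s, ?_⟩⟩
  have h1 := hι2 (b⁻¹ * s)
  rw [hr, ← hι2 s] at h1
  have h2 : b ^ ι (b⁻¹ * s) = b ^ (ι s + 1) := by
    rw [← mul_assoc, mul_left_inj, mul_inv_eq_iff_eq_mul] at h1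
    rw [h1, pow_succ]
  rw [pow_inj_mod, hn, Nat.mod_eq_of_lt (hι1 _)] at h2
  rcases Nat.lt_or_ge (ι s + 1) n with h3 | h3
  · left; rw [h2, Nat.mod_eq_of_lt h3]
  · right
    have h4 : ι s + 1 = n := le_antisymm (hι1 s) h3
    exact ⟨h4, by rw [h2, h4, Nat.mod_self]⟩

end wreath

lemma conj_trick {G : Type u} [Group G] (a c : G) (k : ℕ)
    (h : Commute a ((a * c) ^ k * (c ^ k)⁻¹)) :
    IsConj c (a⁻¹ * (c ^ k * a * (c ^ k)⁻¹) * c) := by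
  rw [isConj_iff]
  refine ⟨((a * c) ^ k * (c ^ k)⁻¹)⁻¹, ?_⟩
  have hck : c ^ k * c = c * c ^ k := (pow_succ c k).symm.trans (pow_succ' c k)
  have hack : (a * c) ^ k * (a * c) = (a * c) * (a * c) ^ k :=
    (pow_succ (a * c) k).symm.trans (pow_succ' (a * c) k)
  generalize hd : c ^ k = d at *
  generalize he : (a * c) ^ k = e at *
  have h1 : a * (e * d⁻¹) = e * d⁻¹ * a := h
  have hd' : d⁻¹ * c = c * d⁻¹ := by
    rw [inv_mul_eq_iff_eq_mul, ← mul_assoc, hck, mul_inv_cancel_right]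
  rw [inv_inv, mul_assoc, inv_mul_eq_iff_eq_mul]
  -- c * (e d⁻¹) = e d⁻¹ * (a⁻¹ * (d a d⁻¹) * c)
  have h2 : e * d⁻¹ * a⁻¹ = a⁻¹ * (e * d⁻¹) := by
    rw [mul_inv_eq_iff_eq_mul, mul_assoc, ← h1, inv_mul_cancel_left]
  calc c * (e * d⁻¹) = a⁻¹ * ((a * c) * e) * d⁻¹ := by group
    _ = a⁻¹ * (e * (a * c)) * d⁻¹ := by rw [hack]
    _ = a⁻¹ * (e * a * (c * d⁻¹)) := by group
    _ = a⁻¹ * (e * a * (d⁻¹ * c)) := by rw [hd']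
    _ = a⁻¹ * (e * d⁻¹) * (d * a * d⁻¹ * c) := by group
    _ = e * d⁻¹ * a⁻¹ * (d * a * d⁻¹ * c) := by rw [h2]
    _ = e * d⁻¹ * (a⁻¹ * (d * a * d⁻¹) * c) := by group

lemma isPPow_of_resid {p : ℕ} (hp : p.Prime) {B : Type u} [Group B] (hB : pConjSep p B)
    {b : B} (hb : IsOfFinOrder b) : ∃ k : ℕ, b ^ p ^ k = 1 := by
  obtain ⟨k, m, hm, hn⟩ := Nat.exists_eq_pow_mul_and_not_dvd
    (orderOf_pos_iff.2 hb).ne' p hp.ne_one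
  refine ⟨k, ?_⟩
  by_contra hg
  obtain ⟨N, hN, hgN⟩ := resid_of_pConjSep hB hg
  have hNn : N.Normal := hN.1
  apply hgN
  rw [← QuotientGroup.eq_one_iff, ← orderOf_eq_one_iff]
  obtain ⟨-, -, h3⟩ := pCoC_iff.1 hN
  obtain ⟨j, hj⟩ := h3 (b ^ p ^ k)
  have d1 : orderOf (QuotientGroup.mk (b ^ p ^ k) : B ⧸ N) ∣ p ^ j := by
    rw [orderOf_dvd_iff_pow_eq_one, ← QuotientGroup.mk_pow, QuotientGroup.eq_one_iff]
    exact hj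
  have d2 : orderOf (QuotientGroup.mk (b ^ p ^ k) : B ⧸ N) ∣ m := by
    rw [orderOf_dvd_iff_pow_eq_one, ← QuotientGroup.mk_pow, ← pow_mul, ← hn,
      pow_orderOf_eq_one]
    rfl
  exact Nat.eq_one_of_dvd_coprimes ((hp.coprime_iff_not_dvd.2 hm).pow_left j) d1 d2

section fwd
variable {A B : Type u} [Group A] [Group B]

lemma comm_of_infinite {p : ℕ} (h : pConjSep p (RWreath A B)) [Infinite B] (x y : A) :
    x * y = y * x := by
  by_contra hxy
  have hne : (SemidirectProduct.inl (bsingle (1 : B) (x * y * (y * x)⁻¹)) : RWreath A B) ≠ 1 := by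
    intro h1
    have h2 : bsingle (1 : B) (x * y * (y * x)⁻¹) = 1 :=
      SemidirectProduct.inl_injective (h1.trans (map_one _).symm)
    have h3 := congrArg (fun f : WreathBase A B => (f : B → A) 1) h2
    simp only [bsingle_same] at h3
    exact hxy (mul_inv_eq_one.1 h3)
  obtain ⟨N, hN, hnN⟩ := resid_of_pConjSep h hne
  have hNn : N.Normal := hN.1
  have hfin : Finite (RWreath A B ⧸ N) := hN.2.1
  obtain ⟨b, c, hbc, he⟩ := Finite.exists_ne_map_eq_of_infinite
    (fun b : B => (QuotientGroup.mk (SemidirectProduct.inr b) : RWreath A B ⧸ N))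
  have hd : (SemidirectProduct.inr (b⁻¹ * c) : RWreath A B) ∈ N := by
    rw [map_mul, map_inv]; exact QuotientGroup.eq.1 he
  set d := b⁻¹ * c with hdd
  have hd1 : d ≠ 1 := fun h => hbc (inv_mul_eq_one.1 h)
  apply hnN
  rw [← QuotientGroup.eq_one_iff]
  have e1 : (QuotientGroup.mk (SemidirectProduct.inl (bsingle (1 : B) y)) : RWreath A B ⧸ N) =
      QuotientGroup.mk (SemidirectProduct.inl (bsingle d y)) := by
    have := inr_inl_inr d (bsingle (1 : B) y)
    rw [wact_bsingle, mul_one] at this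
    rw [← this, QuotientGroup.mk_mul, QuotientGroup.mk_mul, QuotientGroup.mk_inv,
      (QuotientGroup.eq_one_iff _).2 hd]
    simp
  have e2 : bsingle (1 : B) x * bsingle d y = bsingle d y * bsingle (1 : B) x := by
    apply Subtype.ext
    funext t
    change (bsingle (1 : B) x : B → A) t * (bsingle d y : B → A) t =
      (bsingle d y : B → A) t * (bsingle (1 : B) x : B → A) t
    by_cases ht : t = 1
    · rw [bsingle_ne (show t ≠ d from fun h => hd1 (h ▸ ht))]; simp
    · rw [bsingle_ne ht]; simp
  simp only [map_mul, map_inv, QuotientGroup.mk_mul, QuotientGroup.mk_inv]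
  rw [e1, mul_inv_eq_one, ← QuotientGroup.mk_mul, ← QuotientGroup.mk_mul, ← map_mul, ← map_mul, e2]

lemma finOrder_of_sep {p : ℕ} (hp : p.Prime) [Nontrivial A] (h : pConjSep p (RWreath A B))
    (b : B) : IsOfFinOrder b := by
  by_contra hb
  have hinj : Function.Injective (fun n : ℤ => b ^ n) :=
    injective_zpow_iff_not_isOfFinOrder.2 hb
  have hinf : Infinite B := Infinite.of_injective _ hinj
  have hcomm := comm_of_infinite h
  obtain ⟨a0, ha0⟩ := exists_ne (1 : A)
  let a : RWreath A B := SemidirectProduct.inl (bsingle 1 a0)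
  let β : RWreath A B := SemidirectProduct.inr b
  let c : RWreath A B := β ^ (p + 1)
  have hbase : ∀ w : RWreath A B, w.right = 1 → Commute a w := by
    intro w hw
    rw [eq_inl_of_right hw]
    change a * _ = _ * a
    rw [← map_mul, ← map_mul]
    congr 1
    apply Subtype.ext
    funext t
    exact hcomm _ _
  have hnc : ¬ IsConj c (a⁻¹ * (β * a * β⁻¹) * c) := by
    intro hc
    rw [isConj_iff] at hc
    obtain ⟨g, hg⟩ := hc
    rw [mul_inv_eq_iff_eq_mul] at hg
    have hcr : c.right = b ^ (p + 1) := wright_pow _ _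
    have hcl : ∀ s, (c.left : B → A) s = 1 := by
      intro s
      have : c = SemidirectProduct.inr (b ^ (p + 1)) := (map_pow _ _ _).symm
      rw [this]; rfl
    have hu : a⁻¹ * (β * a * β⁻¹) =
        SemidirectProduct.inl ((bsingle 1 a0)⁻¹ * bsingle b a0) := by
      rw [inr_inl_inr, wact_bsingle, mul_one, map_mul, map_inv]
    rw [hu] at hg
    have hgr : b ^ (p + 1) * g.right = g.right * b ^ (p + 1) := by
      have := congrArg SemidirectProduct.right hg
      simp only [SemidirectProduct.mul_right, SemidirectProduct.right_inl, hcr, one_mul] at this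
      exact this.symm
    have hs : ∀ s : B, (g.left : B → A) s =
        ((bsingle (1 : B) a0 : B → A) s)⁻¹ * (bsingle b a0 : B → A) s *
          (g.left : B → A) ((b ^ (p + 1))⁻¹ * s) := by
      intro s
      have := congrArg (fun x : RWreath A B => (x.left : B → A) s) hg
      simp only [wmul_left, hcl, mul_one, SemidirectProduct.left_inl,
        SemidirectProduct.right_inl, SemidirectProduct.mul_right, inv_one, one_mul, hcr] at this
      exact this
    let F : ℤ → A := fun k => (g.left : B → A) (b ^ ((p + 1 : ℤ) * k))
    have hb1 : ∀ k : ℤ, b ^ ((p + 1 : ℤ) * k) ≠ b := by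
      intro k hk
      have := hinj (show b ^ ((p + 1 : ℤ) * k) = b ^ (1 : ℤ) by simpa using hk)
      have h2 : ((p + 1 : ℕ) : ℤ) ∣ 1 := ⟨k, by push_cast; exact this.symm⟩
      have h3 := Int.natCast_dvd_natCast.1 (by simpa using h2 : ((p + 1 : ℕ) : ℤ) ∣ ((1 : ℕ) : ℤ))
      have := Nat.le_of_dvd one_pos h3
      have := hp.pos
      omega
    have hFs : ∀ k : ℤ, (b ^ (p + 1))⁻¹ * b ^ ((p + 1 : ℤ) * k) = b ^ ((p + 1 : ℤ) * (k - 1)) := by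
      intro k
      rw [inv_mul_eq_iff_eq_mul, ← zpow_natCast, ← zpow_add]
      congr 1; push_cast; ring
    have hF : ∀ k : ℤ, k ≠ 0 → F k = F (k - 1) := by
      intro k hk
      have := hs (b ^ ((p + 1 : ℤ) * k))
      rw [bsingle_ne, bsingle_ne (hb1 k), hFs] at this
      · simpa using this
      · intro h0
        have := hinj (show b ^ ((p + 1 : ℤ) * k) = b ^ (0 : ℤ) by simpa using h0)
        rcases mul_eq_zero.1 this with h | h
        · omega
        · exact hk h
    have hF0 : F 0 = a0⁻¹ * F (-1) := by
      have := hs (b ^ ((p + 1 : ℤ) * 0))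
      rw [bsingle_ne (hb1 0), hFs] at this
      simp only [mul_zero, zpow_zero, bsingle_same, mul_one] at this
      simpa [F] using this
    have hpos : ∀ n : ℕ, F n = F 0 := by
      intro n
      induction n with
      | zero => rfl
      | succ n ih => rw [hF _ (by omega), ← ih]; congr 1; push_cast; ring
    have hneg : ∀ n : ℕ, F (-1 - n) = F (-1) := by
      intro n
      induction n with
      | zero => simp
      | succ n ih => rw [← ih, hF (-1 - n) (by omega)]; congr 1; push_cast; ring
    have hfinF : (Function.mulSupport F).Finite := by
      refine Set.Finite.of_injOn (f := fun k : ℤ => b ^ ((p + 1 : ℤ) * k))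
        (t := Function.mulSupport (g.left : B → A)) (fun k hk => hk) ?_ (wfin _)
      intro k _ l _ hkl
      exact mul_left_cancel₀ (by omega) (hinj hkl)
    have z1 : F 0 = 1 := by
      by_contra h0
      refine Set.infinite_of_injective_forall_mem (f := fun n : ℕ => (n : ℤ))
        Nat.cast_injective (s := Function.mulSupport F) (fun n => ?_) hfinF
      rw [Function.mem_mulSupport, hpos]; exact h0
    have z2 : F (-1) = 1 := by
      by_contra h0
      refine Set.infinite_of_injective_forall_mem (f := fun n : ℕ => (-1 - n : ℤ))
        (fun m n hmn => by simp at hmn; exact hmn)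
        (s := Function.mulSupport F) (fun n => ?_) hfinF
      rw [Function.mem_mulSupport, hneg]; exact h0
    rw [z1, z2] at hF0
    exact ha0 (by simpa using hF0.symm)
  obtain ⟨N, hN, hNn, hN2⟩ := h _ _ hnc
  apply hN2
  obtain ⟨-, -, h3⟩ := pCoC_iff.1 hN
  obtain ⟨j, hj⟩ := h3 β
  have hj' : (QuotientGroup.mk β : RWreath A B ⧸ N) ^ p ^ j = 1 := by
    rwa [← QuotientGroup.mk_pow, QuotientGroup.eq_one_iff]
  have hcop : (p + 1).Coprime (orderOf (QuotientGroup.mk β : RWreath A B ⧸ N)) :=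
    Nat.Coprime.coprime_dvd_right (orderOf_dvd_of_pow_eq_one hj')
      (Nat.Coprime.pow_right j (by simp))
  obtain ⟨k, hk⟩ := exists_pow_eq_self_of_coprime hcop
  have hk' : (QuotientGroup.mk β : RWreath A B ⧸ N) = QuotientGroup.mk (c ^ k) := by
    rw [QuotientGroup.mk_pow, QuotientGroup.mk_pow]; exact hk.symm
  have hcj : IsConj c (a⁻¹ * (c ^ k * a * (c ^ k)⁻¹) * c) := by
    apply conj_trick
    apply hbase
    rw [SemidirectProduct.mul_right, SemidirectProduct.inv_right, wright_pow, wright_pow]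
    simp [a]
  have := (QuotientGroup.mk' N).map_isConj hcj
  simp only [QuotientGroup.mk'_apply] at this
  convert this using 1
  simp only [QuotientGroup.mk_mul, QuotientGroup.mk_inv, hk']

end fwd

section case1
variable {A B : Type u} [Group A] [Group B]

lemma wreath_finite [Finite A] [Finite B] : Finite (RWreath A B) := by
  have : Finite (WreathBase A B) := inferInstance
  exact Finite.of_equiv _ (SemidirectProduct.equivProd (φ := wreathAction A B)).symm

lemma wbase_pow_apply (f : WreathBase A B) (n : ℕ) (s : B) :
    ((f ^ n : WreathBase A B) : B → A) s = (f : B → A) s ^ n := by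
  rw [Subgroup.coe_pow]; rfl

lemma wreath_isPGroup {p : ℕ} (hp : p.Prime) [Finite A] (hA : IsPGroup p A)
    (hB : IsPGroup p B) : IsPGroup p (RWreath A B) := by
  have := Fact.mk hp
  intro x
  obtain ⟨a, ha⟩ := hB x.right
  obtain ⟨k, hk⟩ := IsPGroup.iff_card.1 hA
  refine ⟨a + k, ?_⟩
  have h1 : (x ^ p ^ a).right = 1 := by rw [wright_pow, ha]
  rw [pow_add, pow_mul, eq_inl_of_right h1, ← map_pow]
  have : (x ^ p ^ a).left ^ p ^ k = 1 := by
    apply Subtype.ext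
    funext s
    rw [wbase_pow_apply, ← hk]
    exact pow_card_eq_one'
  rw [this, map_one]

def mapBase {A' : Type u} [Group A'] (φ : A →* A') : WreathBase A B →* WreathBase A' B where
  toFun f := ⟨fun s => φ ((f : B → A) s), by
    refine (wfin f).subset ?_
    intro s hs h1
    exact hs (by change φ ((f : B → A) s) = 1; rw [h1, map_one])⟩
  map_one' := Subtype.ext (funext fun s => map_one φ)
  map_mul' f g := Subtype.ext (funext fun s => map_mul φ _ _)

lemma exists_V {p : ℕ} (hp : p.Prime) [Finite B] (hB : IsPGroup p B) {L : Subgroup A}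
    (hL : L ∈ pCoC p A) : ∃ V ∈ pCoC p (RWreath A B),
      ∀ x : RWreath A B, x ∈ V ↔ x.right = 1 ∧ ∀ s, (x.left : B → A) s ∈ L := by
  obtain ⟨hn, hf, hpg⟩ := hL
  have := wreath_finite (A := A ⧸ L) (B := B)
  let Φ : RWreath A B →* RWreath (A ⧸ L) B :=
    SemidirectProduct.map (mapBase (QuotientGroup.mk' L)) (MonoidHom.id B) (fun g => by
      ext f; rfl)
  refine ⟨Φ.ker, ker_mem_pCoC (wreath_isPGroup hp hpg hB) Φ, fun x => ?_⟩
  rw [MonoidHom.mem_ker]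
  constructor
  · intro h
    refine ⟨congrArg SemidirectProduct.right h, fun s => ?_⟩
    have := congrArg (fun z : RWreath (A ⧸ L) B => (z.left : B → A ⧸ L) s) h
    exact (QuotientGroup.eq_one_iff _).1 this
  · rintro ⟨h1, h2⟩
    refine SemidirectProduct.ext (Subtype.ext (funext fun s => ?_)) h1
    exact (QuotientGroup.eq_one_iff _).2 (h2 s)

lemma inl_conj_left (h : WreathBase A B) {x : RWreath A B} (hx : x.right = 1) (s : B) :
    ((SemidirectProduct.inl h * x * (SemidirectProduct.inl h)⁻¹ : RWreath A B).left : B → A) s =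
      (h : B → A) s * (x.left : B → A) s * ((h : B → A) s)⁻¹ := by
  rw [eq_inl_of_right hx, ← map_inv, ← map_mul, ← map_mul]
  rfl

lemma good_case1 {p : ℕ} (hp : p.Prime) (hA : Good p A) [Finite B] (hB : IsPGroup p B) :
    Good p (RWreath A B) := by
  intro x y K hK
  -- shrink K
  let L : Subgroup A := K.comap (SemidirectProduct.inl.comp (bsingle 1))
  have hL : L ∈ pCoC p A := pCoC_comap' _ hK
  have hLn : L.Normal := hL.1
  obtain ⟨V, hV, hVm⟩ := exists_V (B := B) hp hB hL
  have hVK : V ≤ K := by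
    intro v hv
    obtain ⟨h1, h2⟩ := (hVm v).1 hv
    rw [eq_inl_of_right h1]
    exact inl_mem_of_forall hK.1 _ h2
  refine goodAt_of_le hV hVK (fun y H => ?_) y
  -- now the main argument
  have hr : x.right = y.right := by
    obtain ⟨k, hk, hk2⟩ := H V hV
    have h1 := ((hVm _).1 hk2).1
    have h2 := ((hVm _).1 hk).1
    simp only [SemidirectProduct.mul_right, SemidirectProduct.inv_right, h2] at h1
    simpa [mul_inv_eq_one] using h1
  have hVn : V.Normal := hV.1
  have hxy : x * y⁻¹ ∈ V := by
    obtain ⟨k, hk, hk2⟩ := H V hV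
    have := V.mul_mem (V.mul_mem (V.inv_mem hk) hk2) (hVn.conj_mem _ hk y)
    convert this using 1
    group
  obtain ⟨n, hn⟩ : ∃ n, orderOf y.right = n := ⟨_, rfl⟩
  have hnpos : 0 < n := hn ▸ orderOf_pos _
  have hbn : y.right ^ n = 1 := by rw [← hn]; exact pow_orderOf_eq_one _
  have hx1 : (x ^ n).right = 1 := by rw [wright_pow, hr, hbn]
  have hy1 : (y ^ n).right = 1 := by rw [wright_pow, hbn]
  have hh0 : ∀ s, ∃ h0 ∈ L, h0 * ((x ^ n).left : B → A) s * h0⁻¹ =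
      ((y ^ n).left : B → A) s := by
    intro s
    apply hA _ _ L hL
    intro L' hL'
    obtain ⟨V', hV', hV'm⟩ := exists_V (B := B) hp hB hL'
    have hV'n : V'.Normal := hV'.1
    obtain ⟨k, hk, hk2⟩ := H V' hV'
    obtain ⟨hk1, hkL⟩ := (hVm _).1 hk
    refine ⟨(k.left : B → A) s, hkL s, ?_⟩
    have h3 : k * x ^ n * k⁻¹ * (y ^ n)⁻¹ ∈ V' := by
      rw [← QuotientGroup.eq_one_iff] at hk2 ⊢
      rw [← conj_pow]
      rw [QuotientGroup.mk_mul, QuotientGroup.mk_inv, mul_inv_eq_one] at hk2 ⊢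
      rw [QuotientGroup.mk_pow, hk2, QuotientGroup.mk_pow]
    have h4 := ((hV'm _).1 h3).2 s
    rw [eq_inl_of_right hk1, wmul_left, inl_conj_left _ hx1] at h4
    rw [eq_inl_of_right hy1, ← map_inv] at h4
    simp only [SemidirectProduct.mul_right, SemidirectProduct.inv_right, hx1,
      SemidirectProduct.right_inl, SemidirectProduct.left_inl] at h4
    simpa using h4
  choose h0 hh0L hh0 using hh0
  obtain ⟨ι, hι⟩ := exists_iota y.right n hn hnpos
  let h : WreathBase A B := ⟨fun s => (((y ^ ι s).left : B → A) (y.right ^ ι s * s))⁻¹ *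
    h0 (y.right ^ ι s * s) * ((x ^ ι s).left : B → A) (y.right ^ ι s * s), Set.toFinite _⟩
  have hmodL : ∀ i s, (((y ^ i).left : B → A) s)⁻¹ * ((x ^ i).left : B → A) s ∈ L := by
    intro i s
    have h3 : (y ^ i)⁻¹ * x ^ i ∈ V := by
      rw [← QuotientGroup.eq]
      rw [← QuotientGroup.eq_one_iff, QuotientGroup.mk_mul, QuotientGroup.mk_inv,
        mul_inv_eq_one] at hxy
      rw [QuotientGroup.mk_pow, QuotientGroup.mk_pow, hxy]
    have h4 := ((hVm _).1 h3).2 ((y ^ i).right⁻¹ * s)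
    rw [wmul_left] at h4
    have h5 : (((y ^ i)⁻¹).left : B → A) ((y ^ i).right⁻¹ * s) = (((y ^ i).left : B → A) s)⁻¹ := by
      rw [SemidirectProduct.inv_left, wact_apply, inv_inv, mul_inv_cancel_left]
      rfl
    rw [h5, SemidirectProduct.inv_right, inv_inv, mul_inv_cancel_left] at h4
    exact h4
  refine ⟨SemidirectProduct.inl h, (hVm _).2 ⟨rfl, fun s => ?_⟩, ?_⟩
  · change (((y ^ ι s).left : B → A) (y.right ^ ι s * s))⁻¹ *
      h0 (y.right ^ ι s * s) * ((x ^ ι s).left : B → A) (y.right ^ ι s * s) ∈ L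
    have := L.mul_mem (hmodL (ι s) (y.right ^ ι s * s)) (hLn.conj_mem _ (hh0L (y.right ^ ι s * s))
      (((x ^ ι s).left : B → A) (y.right ^ ι s * s))⁻¹)
    convert this using 1
    group
  · refine inl_conj hr h (fun s => ?_)
    rw [hr]
    exact transport hr rfl hbn ι (fun s => (hι s).2) h0
      (fun s => by rw [← hh0 s]; group) (h : B → A) (fun s => rfl) s

end case1

lemma winv_left {A B : Type u} [Group A] [Group B] (x : RWreath A B) (s : B) :
    ((x⁻¹).left : B → A) s = ((x.left : B → A) (x.right * s))⁻¹ := by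
  rw [SemidirectProduct.inv_left, wact_apply, inv_inv]
  rfl

lemma resid_finset {p : ℕ} {G : Type u} [Group G] (h : pConjSep p G) (T : Finset G) :
    ∃ N ∈ pCoC p G, ∀ t ∈ T, t ∈ N → t = 1 := by
  classical
  have : ∀ t : G, ∃ N ∈ pCoC p G, t ∈ N → t = 1 := by
    intro t
    by_cases ht : t = 1
    · exact ⟨⊤, top_mem_pCoC, fun _ => ht⟩
    · obtain ⟨N, hN, hn⟩ := resid_of_pConjSep h ht
      exact ⟨N, hN, fun h => absurd h hn⟩
  choose N hN hN2 using this
  refine ⟨T.inf N, finset_inf_mem_pCoC _ _ hN, fun t ht htN => hN2 t ?_⟩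
  exact (Finset.inf_le (f := N) ht : T.inf N ≤ N t) htN

lemma conj_pow_mem {G : Type u} [Group G] {L : Subgroup G} (hL : L.Normal) {k x y : G}
    (h : k * x * k⁻¹ * y⁻¹ ∈ L) (n : ℕ) : k * x ^ n * k⁻¹ * (y ^ n)⁻¹ ∈ L := by
  rw [← QuotientGroup.eq_one_iff] at h ⊢
  rw [← conj_pow]
  rw [QuotientGroup.mk_mul, QuotientGroup.mk_inv, mul_inv_eq_one] at h ⊢
  rw [QuotientGroup.mk_pow, h, QuotientGroup.mk_pow]

lemma gp_id1 {G : Type u} [Group G] (d k x y : G) :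
    d⁻¹ * (k * x * k⁻¹ * y⁻¹) * d⁻¹⁻¹ = d⁻¹ * k * x * (d⁻¹ * k)⁻¹ * (d⁻¹ * y * d)⁻¹ := by
  group

lemma gp_id2 {G : Type u} [Group G] {d k x y : G} (h : k * x * k⁻¹ = d⁻¹ * y * d) :
    d * k * x * (d * k)⁻¹ = y := by
  have : d * k * x * (d * k)⁻¹ = d * (k * x * k⁻¹) * d⁻¹ := by group
  rw [this, h]; group

lemma gp_id3 {G : Type u} [Group G] (d k x : G) :
    d * k * x * (d * k)⁻¹ = d * (k * x * k⁻¹) * d⁻¹ := by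
  group

section case2
variable {A B : Type u} [CommGroup A] [Group B]

open Classical in
noncomputable def pv (N : Subgroup B) : WreathBase A B →* (B ⧸ N → A) where
  toFun f q := ∏ᶠ s : B, if (QuotientGroup.mk s : B ⧸ N) = q then (f : B → A) s else 1
  map_one' := by
    funext q
    rw [finprod_eq_one_of_forall_eq_one]
    · rfl
    · intro s
      split_ifs <;> rfl
  map_mul' f g := by
    funext q
    have hf : ∀ f : WreathBase A B, Function.HasFiniteMulSupport
        (fun s : B => if (QuotientGroup.mk s : B ⧸ N) = q then (f : B → A) s else 1) := by
      intro f
      refine (wfin f).subset ?_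
      intro s hs
      rw [Function.mem_mulSupport] at hs ⊢
      intro h
      apply hs
      rw [h]; simp
    rw [Pi.mul_apply, ← finprod_mul_distrib (hf f) (hf g)]
    apply finprod_congr
    intro s
    split_ifs
    · rfl
    · simp

open Classical in
lemma pv_apply (N : Subgroup B) (f : WreathBase A B) (q : B ⧸ N) :
    pv N f q = ∏ᶠ s : B, if (QuotientGroup.mk s : B ⧸ N) = q then (f : B → A) s else 1 := rfl

lemma pv_congr (N : Subgroup B) (f g : WreathBase A B) (q : B ⧸ N)
    (h : ∀ s : B, (QuotientGroup.mk s : B ⧸ N) = q → (f : B → A) s = (g : B → A) s) :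
    pv N f q = pv N g q := by
  rw [pv_apply, pv_apply]
  apply finprod_congr
  intro s
  split_ifs with hs
  · exact h s hs
  · rfl

lemma pv_ne (N : Subgroup B) (f : WreathBase A B) (q : B ⧸ N) (h : pv N f q ≠ 1) :
    ∃ s : B, (QuotientGroup.mk s : B ⧸ N) = q ∧ (f : B → A) s ≠ 1 := by
  by_contra hc
  push Not at hc
  apply h
  rw [pv_congr N f 1 q (fun s hs => hc s hs), map_one]
  rfl

lemma pv_eq (N : Subgroup B) (f : WreathBase A B) (t : B)
    (h : ∀ s : B, (f : B → A) s ≠ 1 → t⁻¹ * s ∈ N → t⁻¹ * s = 1) :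
    pv N f (QuotientGroup.mk t) = (f : B → A) t := by
  rw [pv_apply, finprod_eq_single _ t]
  · simp
  · intro s hs
    split_ifs with h1
    · by_contra h2
      exact hs (inv_mul_eq_one.1 (h s h2 (QuotientGroup.eq.1 h1.symm))).symm
    · rfl

lemma pv_act (N : Subgroup B) [N.Normal] (c : B) (f : WreathBase A B) (q : B ⧸ N) :
    pv N (wreathAction A B c f) q = pv N f ((QuotientGroup.mk c)⁻¹ * q) := by
  classical
  rw [pv_apply, pv_apply, ← finprod_comp_equiv (Equiv.mulLeft c⁻¹)
    (f := fun s : B => if (QuotientGroup.mk s : B ⧸ N) = (QuotientGroup.mk c)⁻¹ * q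
      then (f : B → A) s else 1)]
  apply finprod_congr
  intro s
  have : (QuotientGroup.mk (Equiv.mulLeft c⁻¹ s) : B ⧸ N) = (QuotientGroup.mk c)⁻¹ * q ↔
      (QuotientGroup.mk s : B ⧸ N) = q := by
    rw [Equiv.coe_mulLeft, QuotientGroup.mk_mul, QuotientGroup.mk_inv, mul_right_inj]
  by_cases hq : (QuotientGroup.mk s : B ⧸ N) = q
  · rw [if_pos hq, if_pos (this.2 hq)]
    rfl
  · rw [if_neg hq, if_neg (fun h => hq (this.1 h))]

lemma pv_bsingle (N : Subgroup B) (s t : B) (a : A)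
    (h : (QuotientGroup.mk s : B ⧸ N) = QuotientGroup.mk t) :
    pv N (bsingle s a) (QuotientGroup.mk t) = a := by
  rw [← h, pv_eq, bsingle_same]
  intro t ht _
  by_contra h2
  exact ht (bsingle_ne (fun h3 => h2 (by rw [h3]; simp)) a)

lemma pv_bsingle_ne (N : Subgroup B) (s t : B) (a : A)
    (h : (QuotientGroup.mk s : B ⧸ N) ≠ QuotientGroup.mk t) :
    pv N (bsingle s a) (QuotientGroup.mk t) = 1 := by
  by_contra hc
  obtain ⟨r, hr, hr2⟩ := pv_ne _ _ _ hc
  apply hr2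
  apply bsingle_ne
  rintro rfl
  exact h hr

lemma exists_W {p : ℕ} (hp : p.Prime) {L : Subgroup A} {N : Subgroup B}
    (hL : L ∈ pCoC p A) (hN : N ∈ pCoC p B) : ∃ W ∈ pCoC p (RWreath A B),
      ∀ x : RWreath A B, x ∈ W ↔ x.right ∈ N ∧ ∀ q, pv N x.left q ∈ L := by
  obtain ⟨hn, hf, hpg⟩ := hL
  obtain ⟨hNn, hNf, hNp⟩ := hN
  have := wreath_finite (A := A ⧸ L) (B := B ⧸ N)
  let Ψ : WreathBase A B →* WreathBase (A ⧸ L) (B ⧸ N) :=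
    { toFun := fun f => ⟨fun q => QuotientGroup.mk (pv N f q), Set.toFinite _⟩
      map_one' := by
        apply Subtype.ext
        funext q
        change (QuotientGroup.mk (pv N 1 q) : A ⧸ L) = 1
        rw [map_one]; rfl
      map_mul' := fun f g => by
        apply Subtype.ext
        funext q
        change (QuotientGroup.mk (pv N (f * g) q) : A ⧸ L) = _
        rw [map_mul]; rfl }
  let Φ : RWreath A B →* RWreath (A ⧸ L) (B ⧸ N) :=
    SemidirectProduct.map Ψ (QuotientGroup.mk' N) (fun g => by
      refine MonoidHom.ext fun f => Subtype.ext (funext fun q => ?_)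
      change (QuotientGroup.mk (pv N (wreathAction A B g f) q) : A ⧸ L) = _
      rw [pv_act]
      rfl)
  refine ⟨Φ.ker, ker_mem_pCoC (wreath_isPGroup hp hpg hNp) Φ, fun x => ?_⟩
  rw [MonoidHom.mem_ker]
  constructor
  · intro h
    refine ⟨?_, fun q => ?_⟩
    · have : (QuotientGroup.mk x.right : B ⧸ N) = 1 := congrArg SemidirectProduct.right h
      exact (QuotientGroup.eq_one_iff _).1 this
    · have := congrArg (fun z : RWreath (A ⧸ L) (B ⧸ N) => (z.left : B ⧸ N → A ⧸ L) q) h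
      exact (QuotientGroup.eq_one_iff _).1 this
  · rintro ⟨h1, h2⟩
    refine SemidirectProduct.ext (Subtype.ext (funext fun s => ?_)) ?_
    · exact (QuotientGroup.eq_one_iff _).2 (h2 s)
    · exact (QuotientGroup.eq_one_iff _).2 h1

lemma mem_of_pv {K : Subgroup (RWreath A B)} {N : Subgroup B} (hKn : K.Normal)
    (hNn : N.Normal) (hfin : Finite (B ⧸ N))
    (hN : ∀ b ∈ N, (SemidirectProduct.inr b : RWreath A B) ∈ K)
    (x : RWreath A B) (h1 : x.right ∈ N)
    (h2 : ∀ q, (SemidirectProduct.inl (bsingle 1 (pv N x.left q)) : RWreath A B) ∈ K) :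
    x ∈ K := by
  classical
  rw [← SemidirectProduct.inl_left_mul_inr_right x]
  refine K.mul_mem ?_ (hN _ h1)
  let σ : B ⧸ N → B := Quotient.out
  have hσ : ∀ q : B ⧸ N, QuotientGroup.mk (σ q) = q := fun q => QuotientGroup.out_eq' q
  have hcfin : ∀ f : WreathBase A B, (fun t : B => if t = σ (QuotientGroup.mk t) then
      pv N f (QuotientGroup.mk t) else 1) ∈ WreathBase A B := by
    intro f
    refine (Set.finite_range σ).subset ?_
    intro t ht
    by_contra hc
    apply ht
    exact if_neg (fun h => hc ⟨_, h.symm⟩)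
  let C : WreathBase A B →* WreathBase A B :=
    { toFun := fun f => ⟨_, hcfin f⟩
      map_one' := by
        apply Subtype.ext
        funext t
        change (if t = σ (QuotientGroup.mk t) then pv N 1 (QuotientGroup.mk t) else 1) = (1 : A)
        rw [map_one]
        simp
      map_mul' := fun f g => by
        apply Subtype.ext
        funext t
        change (if t = σ (QuotientGroup.mk t) then pv N (f * g) (QuotientGroup.mk t) else 1) =
          (if t = σ (QuotientGroup.mk t) then pv N f (QuotientGroup.mk t) else 1) *
          (if t = σ (QuotientGroup.mk t) then pv N g (QuotientGroup.mk t) else 1)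
        rw [map_mul]
        split_ifs <;> simp }
  have hC : ∀ f t, (C f : B → A) t = if t = σ (QuotientGroup.mk t) then
      pv N f (QuotientGroup.mk t) else 1 := fun f t => rfl
  have hCK : (SemidirectProduct.inl (C x.left) : RWreath A B) ∈ K := by
    apply inl_mem_of_forall hKn
    intro s
    rw [hC]
    split_ifs
    · exact h2 _
    · simp only [map_one]; exact K.one_mem
  let φ1 : WreathBase A B →* RWreath A B ⧸ K :=
    (QuotientGroup.mk' K).comp SemidirectProduct.inl
  have hloc : x.left ∈ MonoidHom.eqLocus φ1 (φ1.comp C) := by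
    apply wbase_mem
    intro s
    generalize (x.left : B → A) s = a
    have hCs : C (bsingle s a) = bsingle (σ (QuotientGroup.mk s)) a := by
      apply Subtype.ext
      funext t
      rw [hC, bsingle_apply]
      by_cases hst : (QuotientGroup.mk s : B ⧸ N) = QuotientGroup.mk t
      · rw [pv_bsingle _ _ _ _ hst, hst]
      · rw [pv_bsingle_ne _ _ _ _ hst, ite_self, if_neg]
        intro h
        apply hst
        rw [h, hσ]
    change φ1 (bsingle s a) = φ1 (C (bsingle s a))
    rw [hCs]
    have hm : s⁻¹ * σ (QuotientGroup.mk s) ∈ N := QuotientGroup.eq.1 (hσ (QuotientGroup.mk s)).symm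
    have hm2 := hN _ (hNn.conj_mem _ hm s)
    rw [mul_inv_cancel_left] at hm2
    have := inr_inl_inr (σ (QuotientGroup.mk s) * s⁻¹) (bsingle s a)
    rw [wact_bsingle, inv_mul_cancel_right] at this
    change (QuotientGroup.mk _ : RWreath A B ⧸ K) = QuotientGroup.mk _
    rw [← this, QuotientGroup.mk_mul, QuotientGroup.mk_mul, QuotientGroup.mk_inv,
      (QuotientGroup.eq_one_iff _).2 hm2]
    simp
  have h3 : φ1 x.left = φ1 (C x.left) := hloc
  have h4 : φ1 (C x.left) = 1 := (QuotientGroup.eq_one_iff _).2 hCK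
  rw [h4] at h3
  exact (QuotientGroup.eq_one_iff _).1 h3

lemma exists_W_le {p : ℕ} (hp : p.Prime) {K : Subgroup (RWreath A B)}
    (hK : K ∈ pCoC p (RWreath A B)) {L0 : Subgroup A} {N0 : Subgroup B}
    (hL0 : L0 ∈ pCoC p A) (hN0 : N0 ∈ pCoC p B) :
    ∃ L ∈ pCoC p A, ∃ N ∈ pCoC p B, ∃ W ∈ pCoC p (RWreath A B), L ≤ L0 ∧ N ≤ N0 ∧ W ≤ K ∧
      ∀ x : RWreath A B, x ∈ W ↔ x.right ∈ N ∧ ∀ q, pv N x.left q ∈ L := by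
  have hL : L0 ⊓ K.comap (SemidirectProduct.inl.comp (bsingle 1)) ∈ pCoC p A :=
    inf_mem_pCoC hL0 (pCoC_comap' _ hK)
  have hN : N0 ⊓ K.comap SemidirectProduct.inr ∈ pCoC p B :=
    inf_mem_pCoC hN0 (pCoC_comap' _ hK)
  obtain ⟨W, hW, hWm⟩ := exists_W hp hL hN
  refine ⟨_, hL, _, hN, W, hW, inf_le_left, inf_le_left, fun x hx => ?_, hWm⟩
  obtain ⟨h1, h2⟩ := (hWm x).1 hx
  exact mem_of_pv hK.1 hN.1 hN.2.1 (fun b hb => hb.2) x h1 (fun q => (h2 q).2)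

lemma exists_sep {p : ℕ} (hA : pConjSep p A) (hB : pConjSep p B) (f : WreathBase A B) (t : B)
    (ht : (f : B → A) t ≠ 1) : ∃ L ∈ pCoC p A, ∃ N ∈ pCoC p B, ∀ L' ≤ L, ∀ N' ≤ N,
      pv N' f (QuotientGroup.mk t) ∉ L' := by
  classical
  obtain ⟨L, hL, hLt⟩ := resid_of_pConjSep hA ht
  obtain ⟨N, hN, hNt⟩ := resid_finset hB ((wfin f).toFinset.image (fun s => t⁻¹ * s))
  refine ⟨L, hL, N, hN, fun L' hL' N' hN' => ?_⟩
  rw [pv_eq]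
  · exact fun h => hLt (hL' h)
  · intro s hs hsN
    refine hNt _ ?_ (hN' hsN)
    rw [Finset.mem_image]
    exact ⟨s, by rw [Set.Finite.mem_toFinset]; exact hs, rfl⟩

lemma wreath_resid {p : ℕ} (hp : p.Prime) (hA : pConjSep p A) (hB : pConjSep p B)
    (g : RWreath A B) (hg : ∀ L ∈ pCoC p (RWreath A B), g ∈ L) : g = 1 := by
  have h1 : g.right = 1 := by
    by_contra hc
    obtain ⟨N, hN, hn⟩ := resid_of_pConjSep hB hc
    exact hn (hg _ (pCoC_comap' SemidirectProduct.rightHom hN))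
  refine SemidirectProduct.ext (Subtype.ext (funext fun t => ?_)) h1
  by_contra hc
  obtain ⟨L, hL, N, hN, h⟩ := exists_sep hA hB g.left t hc
  obtain ⟨W, hW, hWm⟩ := exists_W hp hL hN
  exact h L le_rfl N le_rfl (((hWm g).1 (hg W hW)).2 _)

lemma right_one_comm {x y : RWreath A B} (hx : x.right = 1) (hy : y.right = 1) :
    x * y = y * x := by
  rw [eq_inl_of_right hx, eq_inl_of_right hy, ← map_mul, ← map_mul]
  congr 1
  apply Subtype.ext
  funext t
  exact mul_comm _ _

lemma find_z {p : ℕ} (hp : p.Prime) (hA : pConjSep p A) (hB : pConjSep p B)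
    {x y : RWreath A B} (hr : x.right = y.right) {n : ℕ} (hn : y.right ^ n = 1)
    {W : Subgroup (RWreath A B)} {N : Subgroup B} (hW : W ∈ pCoC p (RWreath A B))
    (hWN : ∀ w ∈ W, w.right ∈ N)
    (H : ∀ L ∈ pCoC p (RWreath A B), ∃ k ∈ W, k * x * k⁻¹ * y⁻¹ ∈ L) :
    ∃ z ∈ N, z * y.right * z⁻¹ = y.right ∧
      (SemidirectProduct.inr z * x ^ n * (SemidirectProduct.inr z)⁻¹ : RWreath A B) = y ^ n := by
  have hx1 : (x ^ n).right = 1 := by rw [wright_pow, hr, hn]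
  have hy1 : (y ^ n).right = 1 := by rw [wright_pow, hn]
  by_cases hyn : y ^ n = 1
  · refine ⟨1, N.one_mem, by group, ?_⟩
    have : x ^ n = 1 := by
      apply wreath_resid hp hA hB
      intro L hL
      obtain ⟨k, -, hk⟩ := H L hL
      have h1 := conj_pow_mem hL.1 hk n
      rw [hyn, inv_one, mul_one] at h1
      have := hL.1.conj_mem _ h1 k⁻¹
      convert this using 1
      group
    rw [this, hyn]; group
  · obtain ⟨t, ht⟩ : ∃ t, ((y ^ n).left : B → A) t ≠ 1 := by
      by_contra hc
      push Not at hc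
      apply hyn
      exact SemidirectProduct.ext (Subtype.ext (funext hc)) hy1
    have hfS : Finite (Function.mulSupport ((x ^ n).left : B → A)) := (wfin _).to_subtype
    obtain ⟨⟨s, hs⟩, hP⟩ := pigeon (p := p) (G := RWreath A B)
      (ι := Function.mulSupport ((x ^ n).left : B → A))
      (fun s L => ∃ k ∈ W, k * x * k⁻¹ * y⁻¹ ∈ L ∧
        (t * (s : B)⁻¹)⁻¹ * k.right ∈ L.map SemidirectProduct.rightHom)
      (by
        rintro i L L' hL ⟨k, h1, h2, h3⟩
        exact ⟨k, h1, hL h2, Subgroup.map_mono hL h3⟩)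
      (by
        intro L hL
        obtain ⟨L0, hL0, N0, hN0, hsep⟩ := exists_sep hA hB (y ^ n).left t ht
        obtain ⟨L1, hL1, N1, hN1, W1, hW1, hLL, hNN, hWL, hW1m⟩ := exists_W_le hp hL hL0 hN0
        have hN1n : N1.Normal := hN1.1
        obtain ⟨k, hk, hk2⟩ := H W1 hW1
        have hk3 := ((hW1m _).1 (conj_pow_mem hW1.1 hk2 n)).2 (QuotientGroup.mk t)
        have hsep' := hsep L1 hLL N1 hNN
        have hzr : (k * x ^ n * k⁻¹).right = 1 := by
          simp [hx1]
        have e1 : (k * x ^ n * k⁻¹ * (y ^ n)⁻¹).left = (k * x ^ n * k⁻¹).left * ((y ^ n).left)⁻¹ := by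
          rw [eq_inl_of_right hzr, eq_inl_of_right hy1, ← map_inv, ← map_mul]
          rfl
        rw [e1, map_mul, map_inv] at hk3
        have hne : pv N1 (k * x ^ n * k⁻¹).left (QuotientGroup.mk t) ≠ 1 := by
          intro h1
          rw [Pi.mul_apply, h1, one_mul, Pi.inv_apply, L1.inv_mem_iff] at hk3
          exact hsep' hk3
        obtain ⟨r, hr1, hr2⟩ := pv_ne _ _ _ hne
        have e2 : ((k * x ^ n * k⁻¹).left : B → A) r = ((x ^ n).left : B → A) (k.right⁻¹ * r) := by
          rw [wmul_left, wmul_left, winv_left]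
          rw [SemidirectProduct.mul_right, hx1, mul_one, mul_inv_cancel_left, mul_comm]
          rw [inv_mul_cancel_left]
        refine ⟨⟨k.right⁻¹ * r, by rw [Function.mem_mulSupport, ← e2]; exact hr2⟩, k, hk,
          hWL hk2, ?_⟩
        have hmem : r * t⁻¹ ∈ N1 := by
          have := hN1n.conj_mem _ (QuotientGroup.eq.1 hr1) r
          have := N1.inv_mem this
          convert this using 1
          group
        refine ⟨SemidirectProduct.inr (k.right⁻¹ * (r * t⁻¹) * k.right), hWL ?_, ?_⟩
        · rw [hW1m]
          refine ⟨?_, fun q => ?_⟩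
          · have := hN1n.conj_mem _ hmem k.right⁻¹
            rw [inv_inv] at this
            exact this
          · rw [SemidirectProduct.left_inr, map_one]
            exact L1.one_mem
        · rw [SemidirectProduct.rightHom_inr]
          group)
    refine ⟨t * s⁻¹, ?_, ?_, ?_⟩
    · obtain ⟨k, hk, -, l, hl, hl2⟩ := hP W hW
      have h1 := N.mul_mem (hWN k hk) (N.inv_mem (hWN l hl))
      have hl2 : l.right = (t * s⁻¹)⁻¹ * k.right := hl2
      rw [hl2] at h1
      convert h1 using 1
      group
    · by_contra hc
      have hc' : t * s⁻¹ * y.right * (t * s⁻¹)⁻¹ * y.right⁻¹ ≠ 1 := fun h =>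
        hc (mul_inv_eq_one.1 h)
      obtain ⟨M, hM, hMn⟩ := resid_of_pConjSep hB hc'
      have hMnn : M.Normal := hM.1
      obtain ⟨k, hk, hk2, l, hl, hl2⟩ := hP _ (pCoC_comap' SemidirectProduct.rightHom hM)
      apply hMn
      have hl1 : l.right ∈ M := hl
      have hl2 : l.right = (t * s⁻¹)⁻¹ * k.right := hl2
      rw [hl2] at hl1
      have hk3 : k.right * x.right * k.right⁻¹ * y.right⁻¹ ∈ M := hk2
      rw [hr] at hk3
      have e := QuotientGroup.eq.2 hl1
      rw [← QuotientGroup.eq_one_iff] at hk3 ⊢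
      simp only [QuotientGroup.mk_mul (N := M), QuotientGroup.mk_inv (N := M)] at hk3 e ⊢
      rw [e]; exact hk3
    · rw [← mul_inv_eq_one]
      apply wreath_resid hp hA hB
      intro L hL
      have hLn : L.Normal := hL.1
      obtain ⟨k, hk, hk2, l, hl, hl2⟩ := hP L hL
      have hl2 : l.right = (t * s⁻¹)⁻¹ * k.right := hl2
      have hk3 := conj_pow_mem hLn hk2 n
      generalize hz : t * s⁻¹ = z at *
      have hh : ((SemidirectProduct.inr z)⁻¹ * k * l⁻¹ : RWreath A B).right = 1 := by
        simp [hl2]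
      generalize hhd : ((SemidirectProduct.inr z)⁻¹ * k * l⁻¹ : RWreath A B) = h at *
      have hkk : k = SemidirectProduct.inr z * h * l := by rw [← hhd]; group
      have hcm := right_one_comm hh hx1
      have e3 : (SemidirectProduct.inr z * x ^ n * (SemidirectProduct.inr z)⁻¹ : RWreath A B) =
          (SemidirectProduct.inr z * h) * x ^ n * (SemidirectProduct.inr z * h)⁻¹ := by
        rw [mul_assoc _ h, hcm]; group
      have ekl : (QuotientGroup.mk k : RWreath A B ⧸ L) =
          QuotientGroup.mk (SemidirectProduct.inr z * h) := by
        rw [hkk, QuotientGroup.mk_mul _ _ l, (QuotientGroup.eq_one_iff l).2 hl, mul_one]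
      rw [e3]
      rw [← QuotientGroup.eq_one_iff] at hk3 ⊢
      rw [QuotientGroup.mk_mul, QuotientGroup.mk_mul, QuotientGroup.mk_mul,
        QuotientGroup.mk_inv] at hk3 ⊢
      rw [← ekl]; exact hk3

set_option maxHeartbeats 1000000 in
lemma good_case2 {p : ℕ} (hp : p.Prime) (hA : pConjSep p A) (hB : pConjSep p B)
    (hBg : Good p B) (hBp : IsPGroup p B) : Good p (RWreath A B) := by
  classical
  intro x y K hK
  obtain ⟨n, hn⟩ : ∃ n, orderOf x.right = n := ⟨_, rfl⟩
  have hnpos : 0 < n := by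
    obtain ⟨k, hk⟩ := hBp x.right
    rw [← hn]
    exact orderOf_pos_iff.2 (isOfFinOrder_iff_pow_eq_one.2 ⟨_, pow_pos hp.pos _, hk⟩)
  have hbn : x.right ^ n = 1 := by rw [← hn]; exact pow_orderOf_eq_one _
  obtain ⟨N0, hN0, hN0b⟩ := resid_finset hB ((Finset.range (n + 1)).image (fun i => x.right ^ i))
  obtain ⟨L, hL, N, hN, W, hW, -, hNN0, hWK, hWm⟩ :=
    exists_W_le hp hK (top_mem_pCoC (p := p) (G := A)) hN0
  have hNn : N.Normal := hN.1
  have hWn : W.Normal := hW.1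
  have hinrW : ∀ c ∈ N, (SemidirectProduct.inr c : RWreath A B) ∈ W := by
    intro c hc
    rw [hWm]
    refine ⟨hc, fun q => ?_⟩
    rw [SemidirectProduct.left_inr, map_one]
    exact L.one_mem
  have hord : orderOf (QuotientGroup.mk x.right : B ⧸ N) = n := by
    have hdvd : orderOf (QuotientGroup.mk x.right : B ⧸ N) ∣ n := by
      rw [orderOf_dvd_iff_pow_eq_one, ← QuotientGroup.mk_pow, hbn]; rfl
    apply Nat.dvd_antisymm hdvd
    rw [← hn, orderOf_dvd_iff_pow_eq_one]
    apply hN0b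
    · rw [Finset.mem_image]
      exact ⟨_, Finset.mem_range.2 (Nat.lt_succ_of_le (Nat.le_of_dvd hnpos hdvd)), rfl⟩
    · apply hNN0
      rw [← QuotientGroup.eq_one_iff, QuotientGroup.mk_pow, pow_orderOf_eq_one]
  refine goodAt_of_le hW hWK (fun y H => ?_) y
  have main : ∀ y : RWreath A B, x.right = y.right →
      (∀ L ∈ pCoC p (RWreath A B), ∃ k ∈ W, k * x * k⁻¹ * y⁻¹ ∈ L) →
      ∃ k ∈ W, k * x * k⁻¹ = y := by
    intro y hr H
    obtain ⟨z, hzN, hzb, hzx⟩ := find_z hp hA hB hr (hr ▸ hbn) hW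
      (fun w hw => ((hWm w).1 hw).1) H
    obtain ⟨x', hx'⟩ : ∃ x' : RWreath A B,
      x' = SemidirectProduct.inr z * x * (SemidirectProduct.inr z)⁻¹ := ⟨_, rfl⟩
    have hx'r : x'.right = y.right := by
      rw [hx', ← hzb, ← hr]; simp
    have hx'n : x' ^ n = y ^ n := by rw [hx', conj_pow, hzx]
    have hx'y : (QuotientGroup.mk x' : RWreath A B ⧸ W) = QuotientGroup.mk y := by
      obtain ⟨k, hk, hk2⟩ := H W hW
      have ek := (QuotientGroup.eq_one_iff _).2 hk
      have ez := (QuotientGroup.eq_one_iff _).2 (hinrW z hzN)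
      rw [← QuotientGroup.eq_one_iff, QuotientGroup.mk_mul, QuotientGroup.mk_inv, mul_inv_eq_one,
        QuotientGroup.mk_mul, QuotientGroup.mk_mul, QuotientGroup.mk_inv, ek] at hk2
      rw [hx', QuotientGroup.mk_mul, QuotientGroup.mk_mul, QuotientGroup.mk_inv, ez]
      exact hk2
    obtain ⟨ι0, hι0⟩ := exists_iota (QuotientGroup.mk x.right : B ⧸ N) n hord hnpos
    let ι : B → ℕ := fun s => ι0 (QuotientGroup.mk s)
    have hyn : y.right ^ n = 1 := hr ▸ hbn
    let w : ℕ → RWreath A B := fun i => (SemidirectProduct.inr (y.right ^ i))⁻¹ *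
      (x' ^ i * (y ^ i)⁻¹) * SemidirectProduct.inr (y.right ^ i)
    have hwW : ∀ i, w i ∈ W := by
      intro i
      have h1 : x' ^ i * (y ^ i)⁻¹ ∈ W := by
        rw [← QuotientGroup.eq_one_iff, QuotientGroup.mk_mul, QuotientGroup.mk_inv, mul_inv_eq_one,
          QuotientGroup.mk_pow, QuotientGroup.mk_pow, hx'y]
      have := hWn.conj_mem _ h1 (SemidirectProduct.inr (y.right ^ i))⁻¹
      rwa [inv_inv] at this
    have hwl : ∀ i s, ((w i).left : B → A) s = (((y ^ i).left : B → A) (y.right ^ i * s))⁻¹ *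
        1 * ((x' ^ i).left : B → A) (y.right ^ i * s) := by
      intro i s
      change (((SemidirectProduct.inr (y.right ^ i))⁻¹ *
        (x' ^ i * (y ^ i)⁻¹) * SemidirectProduct.inr (y.right ^ i) : RWreath A B).left : B → A) s = _
      have e1 : ∀ r : B, ((SemidirectProduct.inr r : RWreath A B).left : B → A) = 1 := fun r => rfl
      rw [wmul_left, wmul_left, wmul_left, winv_left, winv_left]
      simp only [e1, Pi.one_apply, inv_one, one_mul, mul_one, SemidirectProduct.inv_right,
        SemidirectProduct.right_inr, inv_inv, wright_pow, hx'r, mul_inv_cancel_left]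
      rw [mul_comm]
    have hfin : (fun s => ((w (ι s)).left : B → A) s) ∈ WreathBase A B := by
      refine (Set.Finite.biUnion (Finset.range n).finite_toSet
        (fun i _ => wfin (w i).left)).subset ?_
      intro s hs
      rw [Set.mem_iUnion₂]
      exact ⟨ι s, Finset.mem_coe.2 (Finset.mem_range.2 (hι0 _).1), hs⟩
    obtain ⟨h, hh⟩ : ∃ h : WreathBase A B, ∀ s, (h : B → A) s = ((w (ι s)).left : B → A) s :=
      ⟨⟨_, hfin⟩, fun _ => rfl⟩
    have hh2 : ∀ s, (h : B → A) s = (((y ^ ι s).left : B → A) (y.right ^ ι s * s))⁻¹ *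
        (1 : B → A) (y.right ^ ι s * s) * ((x' ^ ι s).left : B → A) (y.right ^ ι s * s) := by
      intro s
      rw [hh, hwl, Pi.one_apply]
    have hh0 : ∀ s, (1 : B → A) s * ((x' ^ n).left : B → A) s =
        ((y ^ n).left : B → A) s * (1 : B → A) s := by
      intro s
      rw [hx'n, Pi.one_apply, one_mul, mul_one]
    have hιs : ∀ s, ι (y.right⁻¹ * s) = ι s + 1 ∨ (ι s + 1 = n ∧ ι (y.right⁻¹ * s) = 0) := by
      intro s
      have := (hι0 (QuotientGroup.mk s)).2
      rw [hr] at this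
      exact this
    have hhW : (SemidirectProduct.inl h : RWreath A B) ∈ W := by
      rw [hWm]
      refine ⟨N.one_mem, fun q => ?_⟩
      have : pv N h q = pv N (w (ι0 q)).left q := by
        apply pv_congr
        intro s hs
        rw [hh, ← hs]
      rw [SemidirectProduct.left_inl, this]
      exact ((hWm _).1 (hwW _)).2 q
    refine ⟨SemidirectProduct.inl h * SemidirectProduct.inr z, W.mul_mem hhW (hinrW z hzN), ?_⟩
    have hfinal : SemidirectProduct.inl h * x' * (SemidirectProduct.inl h)⁻¹ = y := by
      refine inl_conj hx'r h (fun s => ?_)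
      rw [hx'r]
      exact transport hx'r rfl hyn ι hιs 1 hh0 (h : B → A) hh2 s
    rw [← hfinal, hx']
    exact gp_id3 _ _ _
  obtain ⟨c, hcN, hc⟩ := hBg x.right y.right N hN (fun M hM => by
    obtain ⟨k, hk, hk2⟩ := H _ (pCoC_comap' SemidirectProduct.rightHom hM)
    exact ⟨k.right, ((hWm k).1 hk).1, hk2⟩)
  have hd : ∃ d : RWreath A B, d ∈ W ∧ d.right = c := ⟨SemidirectProduct.inr c, hinrW c hcN, rfl⟩
  obtain ⟨d, hdW, hdc⟩ := hd
  have hr : x.right = (d⁻¹ * y * d).right := by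
    rw [SemidirectProduct.mul_right, SemidirectProduct.mul_right, SemidirectProduct.inv_right,
      hdc, ← hc]
    group
  obtain ⟨k, hk, hk2⟩ := main (d⁻¹ * y * d) hr (fun L hL => by
      obtain ⟨k, hk, hk2⟩ := H L hL
      refine ⟨d⁻¹ * k, W.mul_mem (W.inv_mem hdW) hk, ?_⟩
      have := hL.1.conj_mem _ hk2 d⁻¹
      rw [gp_id1] at this
      exact this)
  exact ⟨d * k, W.mul_mem hdW hk, gp_id2 hk2⟩

end case2

lemma good_case2' {p : ℕ} (hp : p.Prime) {A B : Type u} [inst : Group A] [Group B]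
    (hcomm : ∀ x y : A, x * y = y * x) (hA : pConjSep p A) (hB : pConjSep p B)
    (hBg : Good p B) (hBp : IsPGroup p B) : Good p (RWreath A B) := by
  let I : CommGroup A := { inst with mul_comm := hcomm }
  exact @good_case2 A B I _ p hp hA hB hBg hBp

/-- For `p`-hereditarily conjugacy separable groups `A` (nontrivial)
and `B`, the wreath product `A ≀ B` is `p`-hereditarily conjugacy separable iff either
`B` is a finite `p`-group, or `A` is abelian and `B` is a `p`-group. -/
theorem wreath_pHCS_iff (p : ℕ) (hp : p.Prime) (A B : Type u) [Group A] [Group B]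
    [Nontrivial A] (hA : pHCS p A) (hB : pHCS p B) :
    pHCS p (RWreath A B) ↔
      (Finite B ∧ IsPGroup p B) ∨ ((∀ x y : A, x * y = y * x) ∧ IsPGroup p B) := by
  constructor
  · intro h
    have hBp : IsPGroup p B := fun b => isPPow_of_resid hp hB.1 (finOrder_of_sep hp h.1 b)
    rcases finite_or_infinite B with hf | hi
    · exact Or.inl ⟨hf, hBp⟩
    · exact Or.inr ⟨comm_of_infinite h.1, hBp⟩
  · rintro (⟨hf, hBp⟩ | ⟨hc, hBp⟩)
    · exact pHCS_of_good (good_case1 hp (good_of_pHCS hp hA) hBp)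
    · exact pHCS_of_good (good_case2' hp hc hA.1 hB.1 (good_of_pHCS hp hB) hBp)
end
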